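/- arXiv:1504.05151 — 3 statements merged into one kernel-verified Lean document; each statement's English description precedes it below -/
import Mathlib

section
/- Let n ≥ 1 and let p_1,…,p_{n+3} be distinct points of P^n over K that span P^n (i.e. the set {p_1,…,p_{n+3}} is non-degenerate), and let m_1,…,m_{n+3} be positive integers. Set Z = Σ_{i=1}^{n+3} m_i p_i. Then reg(Z) ≤ max{ ⌊(w_L(Z) + r − 2)/r⌋ : 1 ≤ r ≤ n and L an r-dimensional linear subspace of P^n }. -/
open MvPolynomial Module

variable {K : Type*} [Field K]

/-- The homogeneous prime ideal of a point of `ℙⁿ`: the ideal generated by the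
linear forms vanishing at the point (equivalently, all homogeneous forms vanishing there). -/
noncomputable def pointIdeal {n : ℕ} (p : Projectivization K (Fin (n + 1) → K)) :
    Ideal (MvPolynomial (Fin (n + 1)) K) :=
  Ideal.span {f | ∃ c : Fin (n + 1) → K,
    (∑ i, c i * p.rep i) = 0 ∧ f = ∑ i, MvPolynomial.C (c i) * MvPolynomial.X i}

/-- The saturated ideal `I_Z = 𝔭₁^{m₁} ∩ ⋯ ∩ 𝔭_s^{m_s}` of the fat point scheme
`Z = Σ m_i p_i`.  (Points with multiplicity `0` contribute the unit ideal.) -/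
noncomputable def fatIdeal {n s : ℕ} (p : Fin s → Projectivization K (Fin (n + 1) → K))
    (m : Fin s → ℕ) : Ideal (MvPolynomial (Fin (n + 1)) K) :=
  ⨅ i, pointIdeal (p i) ^ m i

/-- `dim_K (R/I)_d`: the dimension of the degree-`d` graded piece of `R/I`,
computed as the dimension of the image of the degree-`d` forms in `R/I`. -/
noncomputable def hilbDim {n : ℕ} (I : Ideal (MvPolynomial (Fin (n + 1)) K)) (d : ℕ) : ℕ :=
  Module.finrank K (Submodule.map (Ideal.Quotient.mkₐ K I).toLinearMap
    (homogeneousSubmodule (Fin (n + 1)) K d))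

/-- `Σ_i C(n + m_i − 1, n)`, the expected degree (number of conditions) of a fat point
scheme with multiplicities `m` in `ℙⁿ`. -/
def expDeg {s : ℕ} (n : ℕ) (m : Fin s → ℕ) : ℕ := ∑ i, Nat.choose (n + m i - 1) n

/-- `h¹(I_Z(d)) = 0`, i.e. the fat point scheme imposes independent conditions on
degree-`d` forms. -/
def H1Zero {n s : ℕ} (p : Fin s → Projectivization K (Fin (n + 1) → K)) (m : Fin s → ℕ)
    (d : ℕ) : Prop :=
  hilbDim (fatIdeal p m) d = expDeg n m

/-- The regularity index of the fat point scheme `Z = Σ m_i p_i`: the least `d ≥ 0`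
with `h¹(I_Z(d)) = 0`. -/
noncomputable def regIndex {n s : ℕ} (p : Fin s → Projectivization K (Fin (n + 1) → K))
    (m : Fin s → ℕ) : ℕ :=
  sInf {d | H1Zero p m d}

/-- The set of points of `ℙⁿ` lying in the linear subspace `P(V)`. -/
def projSet {n : ℕ} (V : Submodule K (Fin (n + 1) → K)) :
    Set (Projectivization K (Fin (n + 1) → K)) :=
  {x | x.rep ∈ V}

open Classical in
/-- `w_L(Z)`: the sum of the multiplicities of the points of `Z` lying in `L`. -/
noncomputable def weightIn {n s : ℕ} (p : Fin s → Projectivization K (Fin (n + 1) → K))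
    (m : Fin s → ℕ) (L : Set (Projectivization K (Fin (n + 1) → K))) : ℕ :=
  ∑ i, if p i ∈ L then m i else 0

section Matroid

open Finset

/-- The axioms of a matroid rank function on the finite subsets of `ι`. -/
structure IsRankFunction {ι : Type*} [DecidableEq ι] (r : Finset ι → ℕ) : Prop where
  empty : r ∅ = 0
  mono : ∀ {A B : Finset ι}, A ⊆ B → r A ≤ r B
  submod : ∀ A B : Finset ι, r (A ∪ B) + r (A ∩ B) ≤ r A + r B
  singleton_le : ∀ j : ι, r {j} ≤ 1

/-- Rado's theorem for colourings. -/
theorem exists_rado_coloring {α κ : Type*} [DecidableEq α] [Fintype κ] [DecidableEq κ]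
    (E : Finset α) (r : Finset α → ℕ) (h0 : r ∅ = 0) (hmono : ∀ {A B : Finset α}, A ⊆ B → r A ≤ r B)
    (hsub : ∀ A B : Finset α, r (A ∪ B) + r (A ∩ B) ≤ r A + r B) (T : α → Finset κ)
    (hT : ∀ A ⊆ E, #A ≤ ∑ c, r {x ∈ A | c ∈ T x}) :
    ∃ U : α → Finset κ, (∀ x ∈ E, ∃ c, U x = {c}) ∧
      ∀ A ⊆ E, #A ≤ ∑ c, r {x ∈ A | c ∈ U x} := by
  induction hN : ∑ x ∈ E, #(T x) using Nat.strong_induction_on generalizing T with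
  | _ N ih =>
  by_cases hall : ∀ x ∈ E, #(T x) ≤ 1
  · refine ⟨T, fun x hx => ?_, hT⟩
    refine card_eq_one.mp (le_antisymm (hall x hx) (card_pos.mpr ?_))
    by_contra hne
    rw [not_nonempty_iff_eq_empty] at hne
    have := hT {x} (by simpa using hx)
    simp [filter_singleton, hne, h0] at this
  · push Not at hall
    obtain ⟨x, hx, hcard⟩ := hall
    obtain ⟨c₁, hc₁, c₂, hc₂, hne⟩ := one_lt_card.mp hcard
    have key : ∀ c ∈ T x,
        (∀ A ⊆ E, #A ≤ ∑ c', r {y ∈ A | c' ∈ Function.update T x ((T x).erase c) y}) →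
        ∃ U : α → Finset κ, (∀ x ∈ E, ∃ c, U x = {c}) ∧
          ∀ A ⊆ E, #A ≤ ∑ c, r {x ∈ A | c ∈ U x} := by
      intro c hc h
      refine ih _ ?_ _ h rfl
      rw [← hN]
      refine sum_lt_sum (fun y _ => ?_) ⟨x, hx, ?_⟩
      · by_cases hy : y = x
        · subst hy; simpa using card_le_card (erase_subset _ _)
        · simp [Function.update_of_ne hy]
      · simpa using card_erase_lt_of_mem hc
    by_contra hcon
    have h₁ := mt (key c₁ hc₁) hcon
    have h₂ := mt (key c₂ hc₂) hcon
    push Not at h₁ h₂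
    obtain ⟨A, hA, hAlt⟩ := h₁
    obtain ⟨B, hB, hBlt⟩ := h₂
    have hxmem : ∀ c, ∀ A ⊆ E, ∑ c', r {y ∈ A | c' ∈ Function.update T x ((T x).erase c) y} < #A →
        x ∈ A := by
      intro c A hA hlt
      by_contra hxA
      refine absurd (hT A hA) (not_le.mpr (lt_of_eq_of_lt (sum_congr rfl fun c' _ => ?_) hlt))
      congr 1
      refine filter_congr fun y hy => ?_
      rw [Function.update_of_ne (by rintro rfl; exact hxA hy)]
    have hxA := hxmem _ A hA hAlt
    have hxB := hxmem _ B hB hBlt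
    have hU := hT (A ∪ B) (union_subset hA hB)
    have hI := hT ((A ∩ B).erase x) ((erase_subset _ _).trans (inter_subset_left.trans hA))
    have hle : ∑ c, r {y ∈ A ∪ B | c ∈ T y} + ∑ c, r {y ∈ (A ∩ B).erase x | c ∈ T y} ≤
        ∑ c', r {y ∈ A | c' ∈ Function.update T x ((T x).erase c₁) y} +
        ∑ c', r {y ∈ B | c' ∈ Function.update T x ((T x).erase c₂) y} := by
      rw [← sum_add_distrib, ← sum_add_distrib]
      refine sum_le_sum fun c _ => ?_
      refine le_trans (add_le_add (hmono ?_) (hmono ?_)) (hsub _ _)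
      · intro y hy
        by_cases hyx : y = x
        · subst hyx
          simp only [mem_filter, mem_union, Function.update_self, mem_erase] at hy ⊢
          grind
        · simp only [mem_filter, mem_union, Function.update_of_ne hyx] at hy ⊢
          tauto
      · intro y hy
        simp only [mem_filter, mem_inter, mem_erase] at hy ⊢
        simp only [Function.update_of_ne hy.1.1]
        tauto
    have := card_union_add_card_inter A B
    have := card_erase_add_one (mem_inter.mpr ⟨hxA, hxB⟩)
    omega

/-- Edmonds' covering theorem with multiplicities. -/
theorem exists_independent_cover {ι : Type*} [DecidableEq ι] {r : Finset ι → ℕ}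
    (hr : IsRankFunction r) (Q : Finset ι) (w : ι → ℕ) (k : ℕ)
    (h : ∀ A ⊆ Q, ∑ j ∈ A, w j ≤ k * r A) :
    ∃ S : Fin k → Finset ι, (∀ t, S t ⊆ Q ∧ #(S t) ≤ r (S t)) ∧
      ∀ j ∈ Q, w j ≤ #{t | j ∈ S t} := by
  set E : Finset (Σ _ : ι, ℕ) := Q.sigma fun j => range (w j) with hE
  obtain ⟨U, hU, hcard⟩ := exists_rado_coloring (κ := Fin k) E (fun A => r (A.image Sigma.fst))
    (by simp [hr.empty]) (fun hAB => hr.mono (image_subset_image hAB))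
    (fun A B => by
      refine le_trans (Nat.add_le_add (hr.mono (image_union _ _).le) (hr.mono ?_)) (hr.submod _ _)
      exact image_inter_subset _ _ _)
    (fun _ => univ) (by
      intro A hA
      have hsub : A.image Sigma.fst ⊆ Q := by
        intro j hj
        obtain ⟨x, hx, rfl⟩ := mem_image.mp hj
        exact (mem_sigma.mp (hA hx)).1
      have h1 : #A ≤ ∑ j ∈ A.image Sigma.fst, w j := by
        have : A ⊆ (A.image Sigma.fst).sigma fun j => range (w j) := fun x hx =>
          mem_sigma.mpr ⟨mem_image_of_mem _ hx, (mem_sigma.mp (hA hx)).2⟩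
        simpa using card_le_card this
      simpa using h1.trans (h _ hsub))
  have hinj : ∀ c : Fin k, ∀ A ⊆ E, (∀ x ∈ A, c ∈ U x) → #A ≤ r (A.image Sigma.fst) := by
    intro c A hA hc
    refine (hcard A hA).trans ?_
    rw [sum_eq_single c]
    · simp only [filter_true_of_mem hc, le_refl]
    · intro c' _ hne
      rw [filter_false_of_mem]
      · simpa using hr.empty
      · intro x hx hx'
        obtain ⟨c'', hc''⟩ := hU x (hA hx)
        have := hc x hx
        simp only [hc'', mem_singleton] at this hx'
        exact hne (hx'.trans this.symm)
    · simp
  refine ⟨fun c => ({x ∈ E | c ∈ U x}).image Sigma.fst, fun c => ⟨?_, ?_⟩, fun j hj => ?_⟩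
  · intro j hj
    obtain ⟨x, hx, rfl⟩ := mem_image.mp hj
    exact (mem_sigma.mp (mem_filter.mp hx).1).1
  · exact card_image_le.trans (hinj c _ (filter_subset _ _) fun x hx => (mem_filter.mp hx).2)
  · have hmemE : ∀ l ∈ range (w j), (⟨j, l⟩ : Σ _ : ι, ℕ) ∈ E := fun l hl =>
      mem_sigma.mpr ⟨hj, hl⟩
    rcases Nat.eq_zero_or_pos (w j) with hw | hw
    · simp [hw]
    have : Nonempty (Fin k) := ⟨(hU _ (hmemE 0 (mem_range.mpr hw))).choose⟩
    choose! col hcol using hU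
    rw [← card_range (w j)]
    refine card_le_card_of_injOn (fun l => col ⟨j, l⟩) ?_ ?_
    · intro l hl
      have hl' := hmemE l hl
      simp only [coe_filter, mem_univ, true_and, Set.mem_ofPred_eq, mem_image, mem_filter]
      exact ⟨⟨j, l⟩, ⟨hl', by simp [hcol _ hl']⟩, rfl⟩
    · intro l hl l' hl' heq
      by_contra hne
      have := hinj (col ⟨j, l⟩) {⟨j, l⟩, ⟨j, l'⟩}
        (by simp only [insert_subset_iff, singleton_subset_iff]
            exact ⟨hmemE l hl, hmemE l' hl'⟩)
        (by
          intro x hx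
          simp only [mem_insert, mem_singleton] at hx
          rcases hx with rfl | rfl
          · simp [hcol _ (hmemE l hl)]
          · simp only at heq
            rw [heq]
            simp [hcol _ (hmemE l' hl')])
      rw [card_pair (by simpa using hne)] at this
      have h1 := hr.singleton_le j
      simp only [image_insert, image_singleton, insert_eq_of_mem, mem_singleton] at this
      omega


namespace IsRankFunction

variable {ι : Type*} [DecidableEq ι] {r : Finset ι → ℕ}

theorem insert_le (hr : IsRankFunction r) (j : ι) (A : Finset ι) : r (insert j A) ≤ r A + 1 := by
  have h1 := hr.submod {j} A
  have h2 := hr.singleton_le j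
  rw [← insert_eq] at h1
  omega

theorem union_le_add_card (hr : IsRankFunction r) (A B : Finset ι) : r (A ∪ B) ≤ r A + #B := by
  induction B using Finset.induction_on with
  | empty => simp
  | insert j B hj ih =>
    rw [union_insert, card_insert_of_notMem hj]
    have := hr.insert_le j (A ∪ B)
    omega

theorem le_add_card_sdiff (hr : IsRankFunction r) (A B : Finset ι) : r B ≤ r A + #(B \ A) := by
  refine (hr.mono ?_).trans (hr.union_le_add_card A (B \ A))
  rw [union_sdiff_self_eq_union]
  exact subset_union_right

theorem le_card (hr : IsRankFunction r) (A : Finset ι) : r A ≤ #A := by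
  simpa [hr.empty] using hr.le_add_card_sdiff ∅ A

theorem card_le_of_subset (hr : IsRankFunction r) {A B : Finset ι} (hAB : A ⊆ B) (hB : #B ≤ r B) :
    #A ≤ r A := by
  have := hr.le_add_card_sdiff A B
  have := card_sdiff_add_card_eq_card hAB
  omega

theorem insert_eq_of_subset (hr : IsRankFunction r) {C D : Finset ι} (hCD : C ⊆ D) {j : ι}
    (h : r (insert j C) = r C) : r (insert j D) = r D := by
  have h1 := hr.submod D (insert j C)
  have h2 : r (insert j D) ≤ r (D ∪ insert j C) := hr.mono (by grind)
  have h3 : r C ≤ r (D ∩ insert j C) := hr.mono (by grind)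
  have h4 : r D ≤ r (insert j D) := hr.mono (subset_insert _ _)
  omega

theorem exists_basis (hr : IsRankFunction r) {C Q : Finset ι} (hCQ : C ⊆ Q) (hC : #C ≤ r C) :
    ∃ B, C ⊆ B ∧ B ⊆ Q ∧ #B ≤ r B ∧ r B = r Q := by
  obtain ⟨B, hB, hmax⟩ := exists_max_image (Q.powerset.filter fun B => C ⊆ B ∧ #B ≤ r B) card
    ⟨C, by simp [hCQ, hC]⟩
  simp only [mem_filter, mem_powerset] at hB hmax
  obtain ⟨hBQ, hCB, hBi⟩ := hB
  refine ⟨B, hCB, hBQ, hBi, le_antisymm (hr.mono hBQ) ?_⟩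
  have key : ∀ D ⊆ Q, r (B ∪ D) ≤ r B := by
    intro D hD
    induction D using Finset.induction_on with
    | empty => simp
    | insert j D hj ih =>
      rw [union_insert]
      have hDQ := (subset_insert j D).trans hD
      refine (le_of_eq (hr.insert_eq_of_subset subset_union_left ?_)).trans (ih hDQ)
      by_cases hjB : j ∈ B
      · rw [insert_eq_of_mem hjB]
      · have h1 := hr.mono (subset_insert j B)
        have h2 := hr.insert_le j B
        by_contra hne
        have := hmax (insert j B) ⟨insert_subset (hD (mem_insert_self _ _)) hBQ,
          hCB.trans (subset_insert _ _), by rw [card_insert_of_notMem hjB]; omega⟩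
        rw [card_insert_of_notMem hjB] at this
        omega
  exact (hr.mono subset_union_right).trans (key Q Subset.rfl)

end IsRankFunction

/-- The hypotheses on the points of a fat point scheme seen from one further point: `r` is the rank
function of the projection from that point, `w` are the multiplicities, and `i` is smaller than
the multiplicity of the further point. -/
structure SegreCondition {ι : Type*} [DecidableEq ι] (r : Finset ι → ℕ) (Q : Finset ι)
    (w : ι → ℕ) (d i : ℕ) : Prop where
  rank : IsRankFunction r
  lt_weight : ∀ j ∈ Q, i < w j
  segre : ∀ A ⊆ Q, A.Nonempty → ∑ j ∈ A, w j + i ≤ d * r A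
  nullity : ∀ A ⊆ Q, #A ≤ r A + 2

/-- The sets of nullity one for which the Segre inequality is almost sharp. -/
structure IsCritical {ι : Type*} (r : Finset ι → ℕ) (Q : Finset ι)
    (w : ι → ℕ) (d i : ℕ) (A : Finset ι) : Prop where
  subset : A ⊆ Q
  card_eq : #A = r A + 1
  lt : d * r A < ∑ j ∈ A, w j + 2 * i

namespace SegreCondition

variable {ι : Type*} [DecidableEq ι] {r : Finset ι → ℕ} {Q : Finset ι} {w : ι → ℕ} {d i : ℕ}

theorem weight_add_le (h : SegreCondition r Q w d i) {j : ι} (hj : j ∈ Q) : w j + i ≤ d := by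
  have h1 := h.segre {j} (by simpa using hj) (singleton_nonempty j)
  have h2 : d * r {j} ≤ d * 1 := Nat.mul_le_mul_left d (h.rank.singleton_le j)
  simp at h1 h2
  omega

theorem sum_weight_add_le (h : SegreCondition r Q w d i) {A : Finset ι} (hA : A ⊆ Q) :
    ∑ j ∈ A, w j + i * #A ≤ d * #A := by
  have := sum_le_sum fun j hj => h.weight_add_le (hA hj)
  rw [sum_add_distrib, sum_const, sum_const, smul_eq_mul, smul_eq_mul] at this
  linarith

variable {A A₁ A₂ A₃ : Finset ι}

theorem rank_erase (h : SegreCondition r Q w d i) (hA : IsCritical r Q w d i A) {j : ι}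
    (hj : j ∈ A) : r (A.erase j) = r A := by
  refine le_antisymm (h.rank.mono (erase_subset _ _)) ?_
  by_contra! hlt
  have hrank := h.rank.insert_le j (A.erase j)
  rw [insert_erase hj] at hrank
  have hc := card_erase_add_one hj
  have hA1 := hA.card_eq
  have hA2 := hA.lt
  have hne : (A.erase j).Nonempty := card_pos.mp (by omega)
  have h1 := h.segre _ ((erase_subset j A).trans hA.subset) hne
  have h2 := h.weight_add_le (hA.subset hj)
  have h3 := add_sum_erase A w hj
  have h4 : r A = r (A.erase j) + 1 := by omega
  rw [h4, Nat.mul_add, Nat.mul_one] at hA2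
  omega

theorem card_le_of_ssubset (h : SegreCondition r Q w d i) (hA : IsCritical r Q w d i A)
    {C : Finset ι} (hC : C ⊂ A) : #C ≤ r C := by
  obtain ⟨j, hj, hCj⟩ := (ssubset_iff_exists_subset_erase).mp hC
  refine h.rank.card_le_of_subset hCj ?_
  have := h.rank_erase hA hj
  have := card_erase_add_one hj
  have := hA.card_eq
  omega

theorem rank_lt_rank_insert (h : SegreCondition r Q w d i) (hA : IsCritical r Q w d i A) {j : ι}
    (hjQ : j ∈ Q) (hj : j ∉ A) : r A < r (insert j A) := by
  by_contra! hle
  have h1 := h.segre (insert j A) (insert_subset hjQ hA.subset) (insert_nonempty _ _)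
  rw [sum_insert hj] at h1
  have h2 : d * r (insert j A) ≤ d * r A := Nat.mul_le_mul_left d hle
  have h3 := h.lt_weight j hjQ
  have h4 := hA.lt
  omega

theorem not_subset (h : SegreCondition r Q w d i) (h₁ : IsCritical r Q w d i A₁)
    (h₂ : IsCritical r Q w d i A₂) (hne : A₁ ≠ A₂) : ¬ A₁ ⊆ A₂ := by
  intro hsub
  have := h.card_le_of_ssubset h₂ (hsub.ssubset_of_ne hne)
  have := h₁.card_eq
  omega

theorem rank_union_inter (h : SegreCondition r Q w d i) (h₁ : IsCritical r Q w d i A₁)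
    (h₂ : IsCritical r Q w d i A₂) (hne : A₁ ≠ A₂) :
    r (A₁ ∪ A₂) + 2 ≤ #(A₁ ∪ A₂) ∧ #(A₁ ∩ A₂) ≤ 2 := by
  have hI : #(A₁ ∩ A₂) ≤ r (A₁ ∩ A₂) := by
    refine h.card_le_of_ssubset h₁ (inter_subset_left.ssubset_of_ne fun heq => ?_)
    exact h.not_subset h₁ h₂ hne (inter_eq_left.mp heq)
  have hs := h.rank.submod A₁ A₂
  have hc := card_union_add_card_inter A₁ A₂
  have e1 := h₁.card_eq
  have e2 := h₂.card_eq
  have l1 := h₁.lt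
  have l2 := h₂.lt
  refine ⟨by omega, ?_⟩
  have hw := sum_union_inter (s₁ := A₁) (s₂ := A₂) (f := w)
  have h3 := h.segre (A₁ ∪ A₂) (union_subset h₁.subset h₂.subset)
    ((card_pos.mp (by omega : 0 < #A₁)).mono subset_union_left)
  have h4 := h.sum_weight_add_le (inter_subset_left.trans h₁.subset : A₁ ∩ A₂ ⊆ Q)
  have h5 : d * (r (A₁ ∪ A₂) + #(A₁ ∩ A₂)) ≤ d * (r A₁ + r A₂) :=
    Nat.mul_le_mul_left d (by omega)
  rw [Nat.mul_add, Nat.mul_add] at h5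
  by_contra! h6
  have h7 : i * 3 ≤ i * #(A₁ ∩ A₂) := Nat.mul_le_mul_left i h6
  omega

theorem subset_union (h : SegreCondition r Q w d i) (h₁ : IsCritical r Q w d i A₁)
    (h₂ : IsCritical r Q w d i A₂) (h₃ : IsCritical r Q w d i A₃) (hne : A₁ ≠ A₂) :
    A₃ ⊆ A₁ ∪ A₂ := by
  intro z hz
  by_contra hzn
  set A := A₁ ∪ A₂ with hA
  have h4 : r A + 2 ≤ #A := (h.rank_union_inter h₁ h₂ hne).1
  have h5 := h.rank.insert_eq_of_subset (C := A₃.erase z) (D := A ∪ A₃.erase z) (j := z)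
    subset_union_right (by rw [insert_erase hz, h.rank_erase h₃ hz])
  have h6 := h.nullity (insert z (A ∪ A₃.erase z)) (by
    have := h₁.subset; have := h₂.subset; have := h₃.subset; grind)
  have h7 := h.rank.le_add_card_sdiff A (A ∪ A₃.erase z)
  have h8 := card_sdiff_add_card_eq_card (subset_union_left : A ⊆ A ∪ A₃.erase z)
  rw [card_insert_of_notMem (by simp [hzn])] at h6
  omega

theorem inter_inter_eq_empty (h : SegreCondition r Q w d i) (h₁ : IsCritical r Q w d i A₁)
    (h₂ : IsCritical r Q w d i A₂) (h₃ : IsCritical r Q w d i A₃) {a b c : ι}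
    (ha₁ : a ∈ A₁) (ha₂ : a ∉ A₂) (ha₃ : a ∈ A₃) (hb₁ : b ∉ A₁) (hb₃ : b ∈ A₃)
    (hc₁ : c ∈ A₁) (hc₂ : c ∈ A₂) (hc₃ : c ∈ A₃) : False := by
  have n12 : A₁ ≠ A₂ := fun e => ha₂ (e ▸ ha₁)
  have n13 : A₁ ≠ A₃ := fun e => hb₁ (e ▸ hb₃)
  have n23 : A₂ ≠ A₃ := fun e => ha₂ (e ▸ ha₃)
  have aux : ∀ {A B C : Finset ι}, A ⊆ B ∪ C → #(B ∩ A) ≤ 2 → #(C ∩ A) ≤ 2 → c ∈ A → c ∈ B →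
      c ∈ C → #A ≤ 3 := by
    intro A B C hA hB hC cA cB cC
    have h1 := card_union_add_card_inter (B ∩ A) (C ∩ A)
    have h2 : #A ≤ #(B ∩ A ∪ C ∩ A) := card_le_card (by grind)
    have h3 : 0 < #(B ∩ A ∩ (C ∩ A)) := card_pos.mpr ⟨c, by grind⟩
    omega
  have i12 := (h.rank_union_inter h₁ h₂ n12).2
  have i13 := (h.rank_union_inter h₁ h₃ n13)
  have i23 := (h.rank_union_inter h₂ h₃ n23).2
  have c3 : #A₃ ≤ 3 := aux (h.subset_union h₁ h₂ h₃ n12) i13.2 i23 hc₃ hc₁ hc₂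
  have c1 : #A₁ ≤ 3 := aux (h.subset_union h₂ h₃ h₁ n23) (by rwa [inter_comm])
    (by rw [inter_comm]; exact i13.2) hc₁ hc₂ hc₃
  clear aux i12 i23
  have hc := card_union_add_card_inter A₁ A₃
  have hac : #({a, c} : Finset ι) ≤ #(A₁ ∩ A₃) := card_le_card (by grind)
  have habc : #({a, b, c} : Finset ι) ≤ #A₃ := card_le_card (by grind)
  rw [card_pair (by rintro rfl; exact ha₂ hc₂)] at hac
  rw [card_eq_three.mpr ⟨a, b, c, by grind, by grind, by grind, rfl⟩] at habc
  obtain ⟨z, hz₁, hz₃⟩ := Finset.not_subset.mp (h.not_subset h₁ h₃ n13)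
  have h5 := h.rank_lt_rank_insert h₃ (h₁.subset hz₁) hz₃
  have h6 := h.rank.mono (by grind : insert z A₃ ⊆ A₁ ∪ A₃)
  have := h₃.card_eq
  omega

/-- There is a basis such that every critical set containing its complement is harmless. -/
theorem exists_basis_critical (h : SegreCondition r Q w d i) :
    ∃ B ⊆ Q, #B ≤ r B ∧ #(Q \ B) ≤ 2 ∧ ∀ A, IsCritical r Q w d i A → Q \ B ⊆ A → #(Q \ B) = 2 →
      ∃ a b A₁ A₂, Q \ B = {a, b} ∧ a ≠ b ∧ A₁ ⊆ B ∧ A₂ ⊆ B ∧ r (insert a A₁) = r A₁ ∧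
        r (insert b A₂) = r A₂ ∧ ∀ c ∈ A ∩ B, c ∈ A₁ → c ∉ A₂ := by
  by_cases h2 : ∃ A₁ A₂, IsCritical r Q w d i A₁ ∧ IsCritical r Q w d i A₂ ∧ A₁ ≠ A₂
  · obtain ⟨A₁, A₂, h₁, h₂, hne⟩ := h2
    obtain ⟨a, ha₁, ha₂⟩ := Finset.not_subset.mp (h.not_subset h₁ h₂ hne)
    obtain ⟨b, hb₂, hb₁⟩ := Finset.not_subset.mp (h.not_subset h₂ h₁ hne.symm)
    have hab : a ≠ b := by rintro rfl; exact ha₂ hb₂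
    have haQ := h₁.subset ha₁
    have hbQ := h₂.subset hb₂
    have hsub : ({a, b} : Finset ι) ⊆ Q := by grind
    have hB₁ : A₁.erase a ⊆ Q \ {a, b} := by have := h₁.subset; grind
    have hB₂ : A₂.erase b ⊆ Q \ {a, b} := by have := h₂.subset; grind
    have ea : r (insert a (A₁.erase a)) = r (A₁.erase a) := by
      rw [insert_erase ha₁, h.rank_erase h₁ ha₁]
    have eb : r (insert b (A₂.erase b)) = r (A₂.erase b) := by
      rw [insert_erase hb₂, h.rank_erase h₂ hb₂]
    have hrank : r Q = r (Q \ {a, b}) := by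
      rw [← h.rank.insert_eq_of_subset hB₁ ea,
        ← h.rank.insert_eq_of_subset (hB₂.trans (subset_insert a _)) eb]
      congr 1
      grind
    have hc := card_sdiff_add_card_eq_card hsub
    rw [card_pair hab] at hc
    have hnull := h.nullity Q Subset.rfl
    have hQB : Q \ (Q \ {a, b}) = {a, b} := Finset.sdiff_sdiff_eq_self hsub
    refine ⟨Q \ {a, b}, sdiff_subset, by omega, by rw [hQB, card_pair hab], fun A hA hAs _ =>
      ⟨a, b, A₁.erase a, A₂.erase b, hQB, hab, hB₁, hB₂, ea, eb, fun c hc hc₁ hc₂ => ?_⟩⟩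
    rw [hQB] at hAs
    exact h.inter_inter_eq_empty h₁ h₂ hA ha₁ ha₂ (hAs (by simp)) hb₁ (hAs (by simp))
      (mem_of_mem_erase hc₁) (mem_of_mem_erase hc₂) (mem_inter.mp hc).1
  · push Not at h2
    have key : ∃ C ⊆ Q, #C ≤ r C ∧ ∀ A, IsCritical r Q w d i A → #(A \ C) ≤ 1 := by
      by_cases h1 : ∃ A, IsCritical r Q w d i A
      · obtain ⟨A, hA⟩ := h1
        have hpos : 0 < #A := by have := hA.card_eq; omega
        obtain ⟨a, ha⟩ := card_pos.mp hpos
        refine ⟨A.erase a, (erase_subset _ _).trans hA.subset,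
          h.card_le_of_ssubset hA (erase_ssubset ha), fun A' hA' => ?_⟩
        rw [h2 A' A hA' hA, sdiff_erase_self ha, card_singleton]
      · exact ⟨∅, empty_subset _, by simp, fun A hA => absurd ⟨A, hA⟩ h1⟩
    obtain ⟨C, hCQ, hC, hcrit⟩ := key
    obtain ⟨B, hCB, hBQ, hB, hrank⟩ := h.rank.exists_basis hCQ hC
    have hc := card_sdiff_add_card_eq_card hBQ
    have hnull := h.nullity Q Subset.rfl
    have := h.rank.le_card B
    refine ⟨B, hBQ, hB, by omega, fun A hA hsub hcard => ?_⟩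
    have h3 := hcrit A hA
    have h4 : #(Q \ B) ≤ #(A \ C) := card_le_card (by grind)
    omega

/-- The covering condition remaining after dividing by a monomial of degree `i` in
the coordinates dual to a suitable basis. -/
theorem exists_basis_reduced_weight (h : SegreCondition r Q w d i) :
    ∃ B ⊆ Q, #B ≤ r B ∧ ∀ e k : ι → ℕ, ∑ j ∈ B, e j ≤ i → (∀ j ∈ Q, k j ≤ i) →
      (∀ j ∈ B, k j + e j = i) →
      (∀ j ∈ Q, ∀ C ⊆ B, r (insert j C) = r C → ∑ l ∈ B \ C, e l ≤ k j) →
      ∀ A ⊆ Q, ∑ j ∈ A, (w j - k j) ≤ (d - i) * r A := by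
  obtain ⟨B, hBQ, hB, hcard, hcrit⟩ := h.exists_basis_critical
  refine ⟨B, hBQ, hB, fun e k he hk hke hspan A hA => ?_⟩
  rcases A.eq_empty_or_nonempty with rfl | hne
  · simp
  have hid : i ≤ d := by
    obtain ⟨j, hj⟩ := hne
    have := h.weight_add_le (hA hj)
    omega
  have hJ : #(A ∩ B) ≤ r A :=
    (h.rank.card_le_of_subset inter_subset_right hB).trans (h.rank.mono inter_subset_left)
  have hle := h.rank.le_card A
  have hAB := card_sdiff_add_card_inter A B
  have hsub : A \ B ⊆ Q \ B := sdiff_subset_sdiff hA Subset.rfl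
  have hTle := (card_le_card hsub).trans hcard
  have heJ : ∑ j ∈ A ∩ B, e j ≤ i := (sum_le_sum_of_subset inter_subset_right).trans he
  have hkJ : ∑ j ∈ A ∩ B, k j + ∑ j ∈ A ∩ B, e j = i * #(A ∩ B) := by
    rw [← sum_add_distrib, sum_congr rfl fun j hj => hke j (mem_inter.mp hj).2, sum_const,
      smul_eq_mul, mul_comm]
  have hkA : ∑ j ∈ A \ B, k j + ∑ j ∈ A ∩ B, k j = ∑ j ∈ A, k j := by
    rw [add_comm]
    exact sum_inter_add_sum_sdiff A B k
  have hwk : ∑ j ∈ A, (w j - k j) + ∑ j ∈ A, k j = ∑ j ∈ A, w j := by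
    rw [← sum_add_distrib]
    refine sum_congr rfl fun j hj => ?_
    have := hk j (hA hj)
    have := h.lt_weight j (hA hj)
    omega
  have hs := h.segre A hA hne
  obtain ⟨c, rfl⟩ := Nat.exists_eq_add_of_le hid
  rw [Nat.add_sub_cancel_left]
  rw [Nat.add_mul] at hs
  by_cases h1 : r A = #(A ∩ B)
  · rw [← h1] at hkJ
    omega
  by_cases h2 : r A = #A
  · rw [h2, mul_comm, ← smul_eq_mul]
    refine sum_le_card_nsmul _ _ _ fun j hj => ?_
    have h3 := h.weight_add_le (hA hj)
    by_cases hjB : j ∈ B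
    · have h4 := hke j hjB
      have h5 : e j ≤ ∑ j ∈ B, e j := single_le_sum (fun _ _ => Nat.zero_le _) hjB
      omega
    · omega
  have hr : r A = #(A ∩ B) + 1 := by omega
  have hr' : i * r A = i * #(A ∩ B) + i := by rw [hr, Nat.mul_add, Nat.mul_one]
  by_cases hc : IsCritical r Q w (i + c) i A
  · have hT : A \ B = Q \ B := eq_of_subset_of_card_le hsub (by omega)
    obtain ⟨a, b, A₁, A₂, hQB, hab, hA₁, hA₂, ha, hb, hdis⟩ :=
      hcrit A hc (hT ▸ sdiff_subset) (by rw [hT] at hAB; omega)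
    have haQ : a ∈ Q \ B := by simp [hQB]
    have hbQ : b ∈ Q \ B := by simp [hQB]
    have h3 := hspan a (mem_sdiff.mp haQ).1 A₁ hA₁ ha
    have h4 := hspan b (mem_sdiff.mp hbQ).1 A₂ hA₂ hb
    have h5 : ∑ j ∈ A ∩ B, e j ≤ ∑ l ∈ B \ A₁, e l + ∑ l ∈ B \ A₂, e l := by
      rw [← sum_union_inter]
      refine le_add_right (sum_le_sum_of_subset fun x hx => ?_)
      have := hdis x hx
      have := (mem_inter.mp hx).2
      simp only [mem_union, mem_sdiff]
      tauto
    rw [hT, hQB, sum_pair hab] at hkA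
    omega
  · have h3 : ¬ ((i + c) * r A < ∑ j ∈ A, w j + 2 * i) := fun h3 => hc ⟨hA, by omega, h3⟩
    rw [Nat.add_mul] at h3
    omega

end SegreCondition

end Matroid

section RelativeRank

variable {K V ι : Type*} [Field K] [AddCommGroup V] [Module K V]

/-- The rank of the images of the vectors `v j`, `j ∈ A`, modulo the line spanned by `u`. -/
noncomputable def relRank (u : V) (v : ι → V) (A : Finset ι) : ℕ :=
  finrank K (Submodule.span K ((K ∙ u).mkQ ∘ v '' (A : Set ι)))

theorem isRankFunction_finrank_span [DecidableEq ι] (v : ι → V) :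
    IsRankFunction fun A : Finset ι => finrank K (Submodule.span K (v '' (A : Set ι))) := by
  have fin (A : Finset ι) : FiniteDimensional K (Submodule.span K (v '' (A : Set ι))) :=
    FiniteDimensional.span_of_finite K (A.finite_toSet.image v)
  have mono {A B : Finset ι} (h : A ⊆ B) :
      Submodule.span K (v '' (A : Set ι)) ≤ Submodule.span K (v '' (B : Set ι)) :=
    Submodule.span_mono (Set.image_mono (by exact_mod_cast h))
  refine ⟨by simp, fun h => Submodule.finrank_mono (mono h), fun A B => ?_, fun j => ?_⟩
  · have h1 := Submodule.finrank_sup_add_finrank_inf_eq (Submodule.span K (v '' (A : Set ι)))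
      (Submodule.span K (v '' (B : Set ι)))
    rw [← Submodule.span_union, ← Set.image_union, ← Finset.coe_union] at h1
    have h2 := Submodule.finrank_mono (le_inf (mono (Finset.inter_subset_left : A ∩ B ⊆ A))
      (mono (Finset.inter_subset_right : A ∩ B ⊆ B)))
    omega
  · rw [Finset.coe_singleton, Set.image_singleton]
    simpa using finrank_span_le_card (R := K) {v j}

theorem isRankFunction_relRank [DecidableEq ι] (u : V) (v : ι → V) :
    IsRankFunction (relRank (K := K) u v) :=
  isRankFunction_finrank_span _

theorem map_mkQ_span_image (u : V) (v : ι → V) (A : Set ι) :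
    (Submodule.span K (v '' A)).map (K ∙ u).mkQ = Submodule.span K ((K ∙ u).mkQ ∘ v '' A) := by
  rw [Submodule.map_span, Set.image_comp]

theorem comap_mkQ_span_image (u : V) (v : ι → V) (A : Set ι) :
    (Submodule.span K ((K ∙ u).mkQ ∘ v '' A)).comap (K ∙ u).mkQ =
      Submodule.span K (insert u (v '' A)) := by
  rw [← map_mkQ_span_image, Submodule.comap_map_mkQ, Submodule.span_insert]

theorem finrank_span_insert_image [FiniteDimensional K V] {u : V} (hu : u ≠ 0) (v : ι → V)
    (A : Finset ι) :
    finrank K (Submodule.span K (insert u (v '' (A : Set ι)))) = relRank (K := K) u v A + 1 := by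
  have h1 := ((K ∙ u).mkQ.domRestrict
    (Submodule.span K (insert u (v '' (A : Set ι))))).finrank_range_add_finrank_ker
  have h2 : (K ∙ u) ≤ Submodule.span K (insert u (v '' (A : Set ι))) :=
    Submodule.span_mono (by simp)
  rw [LinearMap.range_domRestrict, LinearMap.ker_domRestrict, Submodule.ker_mkQ,
    ← Submodule.submoduleOf, LinearEquiv.finrank_eq (Submodule.submoduleOfEquivOfLe h2),
    finrank_span_singleton hu,
    ← comap_mkQ_span_image, Submodule.map_comap_eq_of_surjective (Submodule.mkQ_surjective _)] at h1
  rw [← comap_mkQ_span_image, ← h1, relRank]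

theorem linearIndepOn_of_card_le_relRank {u : V} {v : ι → V} {A : Finset ι}
    (h : A.card ≤ relRank (K := K) u v A) : LinearIndepOn K ((K ∙ u).mkQ ∘ v) (A : Set ι) := by
  refine linearIndependent_iff_card_le_finrank_span.mpr ?_
  rw [relRank, Set.image_eq_range] at h
  simpa [Set.finrank] using h

theorem notMem_span_image {u : V} (hu : u ≠ 0) {v : ι → V} {A : Finset ι}
    (h : A.card ≤ relRank (K := K) u v A) : u ∉ Submodule.span K (v '' (A : Set ι)) := by
  intro hmem
  obtain ⟨l, hl, rfl⟩ := (Finsupp.mem_span_image_iff_linearCombination K).mp hmem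
  have h0 := linearIndepOn_iff.mp (linearIndepOn_of_card_le_relRank h) l hl (by
    rw [← Finsupp.apply_linearCombination, Submodule.mkQ_apply, Submodule.Quotient.mk_eq_zero]
    exact Submodule.mem_span_singleton_self _)
  exact hu (by rw [h0, map_zero])

theorem exists_dual_of_card_le_relRank {u : V} (hu : u ≠ 0) {v : ι → V} {A : Finset ι}
    (h : A.card ≤ relRank (K := K) u v A) : ∃ φ : V →ₗ[K] K, φ u = 1 ∧ ∀ j ∈ A, φ (v j) = 0 := by
  obtain ⟨φ, h1, h2⟩ := Submodule.exists_le_ker_of_notMem (notMem_span_image hu h)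
  refine ⟨(φ u)⁻¹ • φ, by simp [h1], fun j hj => ?_⟩
  have h3 : φ (v j) = 0 := h2 (Submodule.subset_span ⟨j, hj, rfl⟩)
  simp [h3]

theorem mem_span_insert_of_relRank_eq [DecidableEq ι] {u : V} {v : ι → V} {C : Finset ι} {j : ι}
    (h : relRank (K := K) u v (insert j C) = relRank (K := K) u v C) :
    v j ∈ Submodule.span K (insert u (v '' (C : Set ι))) := by
  have : FiniteDimensional K (Submodule.span K ((K ∙ u).mkQ ∘ v '' (insert j C : Finset ι))) :=
    FiniteDimensional.span_of_finite K ((insert j C).finite_toSet.image _)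
  have h1 := Submodule.eq_of_le_of_finrank_le (Submodule.span_mono (Set.image_mono
    (by simp : (C : Set ι) ⊆ (insert j C : Finset ι)))) h.le
  rw [← comap_mkQ_span_image, Submodule.mem_comap, h1]
  exact Submodule.subset_span ⟨j, by simp, rfl⟩

theorem exists_basis_of_card_le_relRank [FiniteDimensional K V] {n : ℕ}
    (hn : finrank K V = n + 1) {u : V} (hu : u ≠ 0) {v : ι → V} {B : Finset ι}
    (h : B.card ≤ relRank (K := K) u v B) :
    ∃ (b : Basis (Fin (n + 1)) K V) (k : ι → Fin (n + 1)), b 0 = u ∧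
      (∀ j ∈ B, k j ≠ 0 ∧ b (k j) = v j) ∧ Set.InjOn k B := by
  have hv : LinearIndepOn K v (B : Set ι) := (linearIndepOn_of_card_le_relRank h).of_comp _
  have hunot := notMem_span_image hu h
  have hs := hv.id_image.id_insert hunot
  let b₀ := Basis.extend hs
  have : Fintype (hs.extend (Set.subset_univ _)) := FiniteDimensional.fintypeBasisIndex b₀
  have hmem : ∀ x ∈ insert u (v '' (B : Set ι)), ∃ k, b₀ k = x := fun x hx =>
    ⟨⟨x, Basis.subset_extend hs hx⟩, Basis.extend_apply_self hs _⟩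
  let e₀ := Fintype.equivFinOfCardEq ((finrank_eq_card_basis b₀).symm.trans hn)
  obtain ⟨k₀, hk₀⟩ := hmem u (by simp)
  let b := b₀.reindex (e₀.trans (Equiv.swap (e₀ k₀) 0))
  have hb0 : b 0 = u := by simp [b, hk₀]
  have hk : ∀ j, ∃ k, j ∈ B → b k = v j := by
    intro j
    by_cases hj : j ∈ B
    · obtain ⟨k, hk⟩ := hmem (v j) (by simpa using Or.inr ⟨j, hj, rfl⟩)
      exact ⟨e₀.trans (Equiv.swap (e₀ k₀) 0) k, fun _ => by simpa [b] using hk⟩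
    · exact ⟨0, fun h => absurd h hj⟩
  choose k hk using hk
  refine ⟨b, k, hb0, fun j hj => ⟨fun h0 => hunot ?_, hk j hj⟩, fun j hj j' hj' hjj' => ?_⟩
  · rw [← hb0, ← h0, hk j hj]
    exact Submodule.subset_span ⟨j, hj, rfl⟩
  · exact hv.injOn hj hj' (by rw [← hk j hj, ← hk j' hj', hjj'])

end RelativeRank

section FatPoint

variable {K : Type*} [Field K] {n : ℕ}

/-- The linear form of degree one attached to a functional on `Kⁿ⁺¹`. -/
noncomputable def linForm : ((Fin (n + 1) → K) →ₗ[K] K) →ₗ[K] MvPolynomial (Fin (n + 1)) K where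
  toFun φ := ∑ i, C (φ (Pi.single i 1)) * X i
  map_add' φ ψ := by simp [add_mul, Finset.sum_add_distrib]
  map_smul' c φ := by simp [mul_assoc, Finset.smul_sum, smul_eq_C_mul]

theorem linForm_apply (φ : (Fin (n + 1) → K) →ₗ[K] K) :
    linForm φ = ∑ i, C (φ (Pi.single i 1)) * X i := rfl

theorem sum_apply_single_mul (φ : (Fin (n + 1) → K) →ₗ[K] K) (v : Fin (n + 1) → K) :
    ∑ i, φ (Pi.single i 1) * v i = φ v := by
  conv_rhs => rw [← (Pi.basisFun K (Fin (n + 1))).sum_repr v]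
  simp [mul_comm]

theorem isHomogeneous_linForm (φ : (Fin (n + 1) → K) →ₗ[K] K) : (linForm φ).IsHomogeneous 1 :=
  IsHomogeneous.sum _ _ _ fun i _ => by
    simpa using (isHomogeneous_C _ _).mul (isHomogeneous_X K i)

/-- The ideal generated by the linear forms vanishing at a vector. -/
noncomputable def vectorIdeal (v : Fin (n + 1) → K) : Ideal (MvPolynomial (Fin (n + 1)) K) :=
  Ideal.span (linForm '' {φ | φ v = 0})

theorem pointIdeal_eq_vectorIdeal (p : Projectivization K (Fin (n + 1) → K)) :
    pointIdeal p = vectorIdeal p.rep := by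
  rw [pointIdeal, vectorIdeal]
  congr 1
  ext f
  simp only [Set.mem_ofPred_eq, Set.mem_image]
  constructor
  · rintro ⟨c, hc, rfl⟩
    refine ⟨∑ i, c i • LinearMap.proj i, by simpa using hc, ?_⟩
    simp [linForm_apply, Pi.single_apply, smul_eq_C_mul]
  · rintro ⟨φ, hφ, rfl⟩
    exact ⟨fun i => φ (Pi.single i 1), (sum_apply_single_mul φ _).trans hφ, rfl⟩

theorem linForm_mem_vectorIdeal {φ : (Fin (n + 1) → K) →ₗ[K] K} {v : Fin (n + 1) → K}
    (h : φ v = 0) : linForm φ ∈ vectorIdeal v :=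
  Ideal.subset_span ⟨φ, h, rfl⟩

/-- The ideal of the coordinate point `[1 : 0 : ⋯ : 0]`. -/
noncomputable def coordIdeal (K : Type*) [Field K] (n : ℕ) : Ideal (MvPolynomial (Fin (n + 1)) K) :=
  Ideal.span (X '' {0}ᶜ)

theorem sum_erase_zero_add (s : Fin (n + 1) →₀ ℕ) :
    ∑ k ∈ Finset.univ.erase 0, s k + s 0 = s.degree := by
  rw [Finsupp.degree_eq_sum, Finset.sum_erase_add _ _ (Finset.mem_univ _)]

theorem monomial_mem_coordIdeal_pow {s : Fin (n + 1) →₀ ℕ} {m : ℕ}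
    (h : m ≤ ∑ k ∈ Finset.univ.erase 0, s k) (c : K) : monomial s c ∈ coordIdeal K n ^ m := by
  rw [monomial_eq, Finsupp.prod_fintype _ _ (by simp),
    ← Finset.prod_erase_mul _ _ (Finset.mem_univ 0)]
  refine Ideal.mul_mem_left _ _ (Ideal.mul_mem_right _ _ (Ideal.pow_le_pow_right h ?_))
  rw [← Finset.prod_pow_eq_pow_sum]
  exact Ideal.prod_mem_prod fun k hk => Ideal.pow_mem_pow
    (Ideal.subset_span (Set.mem_image_of_mem X (by simpa using hk))) _

theorem le_of_mem_coordIdeal_pow {m : ℕ} : ∀ {f : MvPolynomial (Fin (n + 1)) K},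
    f ∈ coordIdeal K n ^ m → ∀ s ∈ f.support, m ≤ ∑ k ∈ Finset.univ.erase 0, s k := by
  classical
  induction m with
  | zero => simp
  | succ m ih =>
    intro f hf
    rw [pow_succ] at hf
    refine Submodule.mul_induction_on hf (fun g hg h hh s hs => ?_) fun x y hx hy s hs => ?_
    · obtain ⟨a, ha, b, hb, rfl⟩ := Finset.mem_add.mp (support_mul _ _ hs)
      obtain ⟨k, hk, hbk⟩ := mem_ideal_span_X_image.mp hh b hb
      have h1 := ih hg a ha
      have h2 : b k ≤ ∑ k ∈ Finset.univ.erase 0, b k :=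
        Finset.single_le_sum (fun _ _ => Nat.zero_le _) (by simpa using hk)
      simp only [Finsupp.add_apply, Finset.sum_add_distrib]
      omega
    · rcases Finset.mem_union.mp (support_add hs) with h | h
      exacts [hx s h, hy s h]

theorem mem_coordIdeal_pow_iff {m : ℕ} {f : MvPolynomial (Fin (n + 1)) K} :
    f ∈ coordIdeal K n ^ m ↔ ∀ s ∈ f.support, m ≤ ∑ k ∈ Finset.univ.erase 0, s k := by
  refine ⟨le_of_mem_coordIdeal_pow, fun h => ?_⟩
  rw [f.as_sum]
  exact Ideal.sum_mem _ fun s hs => monomial_mem_coordIdeal_pow (h s hs) _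

/-- The linear change of coordinates attached to a basis. -/
noncomputable def coordEquiv (b : Basis (Fin (n + 1)) K (Fin (n + 1) → K)) :
    MvPolynomial (Fin (n + 1)) K ≃ₐ[K] MvPolynomial (Fin (n + 1)) K :=
  AlgEquiv.ofAlgHom (aeval fun k => linForm (b.coord k)) (aeval fun i => ∑ k, C (b k i) * X k)
    (by
      refine algHom_ext fun i => ?_
      have h : ∑ k, b k i • b.coord k = LinearMap.proj i :=
        b.ext fun j => by simp [Finsupp.single_apply]
      have hX : linForm (LinearMap.proj i) = (X i : MvPolynomial (Fin (n + 1)) K) := by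
        simp [linForm_apply, Pi.single_apply]
      simp only [AlgHom.comp_apply, aeval_X, map_sum, map_mul, AlgHom.id_apply, algHom_C,
        algebraMap_eq]
      rw [← hX, ← h]
      simp [smul_eq_C_mul])
    (by
      refine algHom_ext fun k => ?_
      simp only [AlgHom.comp_apply, aeval_X, linForm_apply, map_sum, map_mul, AlgHom.id_apply,
        Finset.mul_sum, algHom_C, algebraMap_eq]
      rw [Finset.sum_comm]
      simp only [← mul_assoc, ← Finset.sum_mul, ← map_mul, ← map_sum, sum_apply_single_mul]
      simp [Finsupp.single_apply])

variable (b : Basis (Fin (n + 1)) K (Fin (n + 1) → K))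

theorem coordEquiv_X (k : Fin (n + 1)) : coordEquiv b (X k) = linForm (b.coord k) := by
  simp [coordEquiv]

theorem isHomogeneous_coordEquiv {f : MvPolynomial (Fin (n + 1)) K} {d : ℕ}
    (hf : f.IsHomogeneous d) :
    (coordEquiv b f).IsHomogeneous d := by
  simpa [coordEquiv] using hf.aeval (fun k => linForm (b.coord k)) fun k =>
    isHomogeneous_linForm (b.coord k)

theorem isHomogeneous_coordEquiv_symm {f : MvPolynomial (Fin (n + 1)) K} {d : ℕ}
    (hf : f.IsHomogeneous d) :
    ((coordEquiv b).symm f).IsHomogeneous d := by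
  rw [← one_mul d]
  exact hf.aeval (fun i => ∑ k, C (b k i) * X k) fun i =>
    IsHomogeneous.sum _ _ 1 fun k _ => by
      simpa using (isHomogeneous_C _ _).mul (isHomogeneous_X K k)

theorem map_coordEquiv_coordIdeal : (coordIdeal K n).map (coordEquiv b) = vectorIdeal (b 0) := by
  refine le_antisymm ?_ ?_
  · rw [coordIdeal, Ideal.map_span, Ideal.span_le]
    rintro _ ⟨_, ⟨k, hk, rfl⟩, rfl⟩
    rw [coordEquiv_X]
    exact linForm_mem_vectorIdeal (by simpa [Finsupp.single_apply] using Ne.symm hk)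
  · rw [vectorIdeal, Ideal.span_le]
    rintro _ ⟨φ, hφ, rfl⟩
    have h1 : φ = ∑ k, φ (b k) • b.coord k := by
      refine b.ext fun i => ?_
      simp
    rw [h1, map_sum]
    refine Ideal.sum_mem _ fun k _ => ?_
    rw [map_smul, ← coordEquiv_X]
    by_cases hk : k = 0
    · subst hk
      simp [Set.mem_ofPred_eq.mp hφ]
    · exact Submodule.smul_of_tower_mem _ _
        (Ideal.mem_map_of_mem _ (Ideal.subset_span ⟨k, hk, rfl⟩))

theorem map_coordEquiv_coordIdeal_pow (m : ℕ) :
    (coordIdeal K n ^ m).map (coordEquiv b) = vectorIdeal (b 0) ^ m := by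
  rw [Ideal.map_pow, map_coordEquiv_coordIdeal]

theorem coordEquiv_symm_mem_iff {f : MvPolynomial (Fin (n + 1)) K} {m : ℕ} :
    (coordEquiv b).symm f ∈ coordIdeal K n ^ m ↔ f ∈ vectorIdeal (b 0) ^ m := by
  rw [← map_coordEquiv_coordIdeal_pow, Ideal.mem_map_of_equiv]
  exact ⟨fun h => ⟨_, h, by simp⟩, fun ⟨g, hg, h⟩ => by simpa [← h] using hg⟩

end FatPoint

section Approximation

variable {K ι : Type*} [Field K] {n : ℕ}

theorem Ideal.prod_mem_pow_sum_filter {R α : Type*} [CommRing R] (I : Ideal R) (U : Finset α)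
    (q : α → Prop) [DecidablePred q] (f : α → R) (a : α → ℕ)
    (h : ∀ k ∈ U, q k → f k ∈ I ^ a k) : ∏ k ∈ U, f k ∈ I ^ ∑ k ∈ U with q k, a k := by
  rw [← Finset.prod_filter_mul_prod_filter_not U q, ← Finset.prod_pow_eq_pow_sum]
  refine Ideal.mul_mem_right _ _ (Ideal.prod_mem_prod fun k hk => ?_)
  rw [Finset.mem_filter] at hk
  exact h k hk.1 hk.2

/-- The ideal of the fat points `w j • [v j]`, `j ∈ Q`. -/
noncomputable def vectorsIdeal (v : ι → Fin (n + 1) → K) (w : ι → ℕ) (Q : Finset ι) :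
    Ideal (MvPolynomial (Fin (n + 1)) K) :=
  ⨅ j ∈ Q, vectorIdeal (v j) ^ w j

variable [DecidableEq ι] {u : Fin (n + 1) → K} {v : ι → Fin (n + 1) → K} {Q : Finset ι} {w : ι → ℕ}
  {d i : ℕ}

theorem exists_linForm_prod (hu : u ≠ 0) (k : ι → ℕ)
    (h : ∀ A ⊆ Q, ∑ j ∈ A, (w j - k j) ≤ (d - i) * relRank (K := K) u v A) :
    ∃ φ : Fin (d - i) → (Fin (n + 1) → K) →ₗ[K] K, (∀ t, φ t u = 1) ∧
      ∀ j ∈ Q, ∏ t, linForm (φ t) ∈ vectorIdeal (v j) ^ (w j - k j) := by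
  obtain ⟨S, hS, hcov⟩ := exists_independent_cover (isRankFunction_relRank u v) Q _ _ h
  choose φ hφu hφ using fun t => exists_dual_of_card_le_relRank hu (hS t).2
  refine ⟨φ, hφu, fun j hj => Ideal.pow_le_pow_right (hcov j hj) ?_⟩
  rw [Finset.card_eq_sum_ones]
  exact Ideal.prod_mem_pow_sum_filter _ _ _ _ _ fun t _ ht => by
    simpa using linForm_mem_vectorIdeal (hφ t j ht)

theorem prod_linForm_sub_pow_mem {m : ℕ} (φ : Fin m → (Fin (n + 1) → K) →ₗ[K] K)
    (ψ : (Fin (n + 1) → K) →ₗ[K] K) (h : ∀ t, φ t u = ψ u) :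
    linForm ψ ^ m - ∏ t, linForm (φ t) ∈ vectorIdeal u := by
  have h1 (t) : Ideal.Quotient.mk (vectorIdeal u) (linForm (φ t)) =
      Ideal.Quotient.mk _ (linForm ψ) := by
    rw [Ideal.Quotient.mk_eq_mk_iff_sub_mem, ← map_sub]
    exact linForm_mem_vectorIdeal (by simp [h])
  rw [← Ideal.Quotient.mk_eq_mk_iff_sub_mem, map_prod, map_pow]
  simp [h1]

/-- Degree `d` forms vanishing to order `i` at `u` agree, up to forms vanishing to order `i + 1`
at `u`, with forms in the ideal of the other fat points. -/
theorem homogeneous_inf_vectorIdeal_pow_le (hu : u ≠ 0)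
    (h : SegreCondition (relRank (K := K) u v) Q w d i) :
    homogeneousSubmodule (Fin (n + 1)) K d ⊓ (vectorIdeal u ^ i).restrictScalars K ≤
      homogeneousSubmodule (Fin (n + 1)) K d ⊓ (vectorsIdeal v w Q).restrictScalars K ⊔
        (vectorIdeal u ^ (i + 1)).restrictScalars K := by
  classical
  obtain ⟨B, hBQ, hB, hred⟩ := h.exists_basis_reduced_weight
  obtain ⟨b, k, hb0, hk, hinj⟩ := exists_basis_of_card_le_relRank (n := n) (by simp) hu hB
  rintro f ⟨hfd, hfi⟩
  set g := (coordEquiv b).symm f with hg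
  have hgd : g.IsHomogeneous d := isHomogeneous_coordEquiv_symm b hfd
  have hgi : g ∈ coordIdeal K n ^ i := by
    rw [hg, coordEquiv_symm_mem_iff, hb0]
    exact hfi
  have hfg : f = coordEquiv b g := by simp [hg]
  rw [hfg, g.as_sum, map_sum]
  refine Submodule.sum_mem _ fun s hs => ?_
  have hsd : s.degree = d := by
    rw [Finsupp.degree_eq_weight_one]
    exact hgd (mem_support_iff.mp hs)
  have hsum := sum_erase_zero_add s
  rcases (mem_coordIdeal_pow_iff.mp hgi s hs).lt_or_eq with hlt | heq
  · refine Submodule.mem_sup_right ?_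
    have := Ideal.mem_map_of_mem (coordEquiv b) (monomial_mem_coordIdeal_pow hlt (g.coeff s))
    rwa [map_coordEquiv_coordIdeal_pow, hb0] at this
  let κ : ι → ℕ := fun j => ∑ l ∈ Finset.univ.erase 0 with b.coord l (v j) = 0, s l
  have hκ := hred (fun j => s (k j)) κ ?_ ?_ ?_ ?_
  rotate_left
  · rw [heq, ← Finset.sum_image (f := s) hinj]
    refine Finset.sum_le_sum_of_subset fun l hl => ?_
    obtain ⟨j, hj, rfl⟩ := Finset.mem_image.mp hl
    simpa using (hk j hj).1
  · rintro j -
    exact heq ▸ Finset.sum_le_sum_of_subset (Finset.filter_subset _ _)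
  · intro j hj
    rw [heq, ← Finset.sum_erase_add _ _ (show k j ∈ Finset.univ.erase 0 by simpa using (hk j hj).1)]
    refine congrArg (· + s (k j)) (Finset.sum_congr (Finset.ext fun l => ?_) fun _ _ => rfl)
    simp [← (hk j hj).2, Finsupp.single_apply, and_comm, eq_comm]
  · intro j _ D hD hr
    have hker : ∀ l ∈ B \ D, b.coord (k l) (v j) = 0 := by
      intro l hl
      rw [Finset.mem_sdiff] at hl
      refine (Submodule.span_le (p := LinearMap.ker (b.coord (k l)))).mpr ?_
        (mem_span_insert_of_relRank_eq hr)
      rintro x (rfl | ⟨c, hc, rfl⟩)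
      · simpa [← hb0, Finsupp.single_apply] using (hk l hl.1).1.symm
      · have hcl : k c ≠ k l := fun e => hl.2 (hinj (hD hc) hl.1 e ▸ hc)
        simp [← (hk c (hD hc)).2, hcl]
    rw [← Finset.sum_image (f := s) (hinj.mono (by simp))]
    refine Finset.sum_le_sum_of_subset fun l hl => ?_
    obtain ⟨c, hc, rfl⟩ := Finset.mem_image.mp hl
    exact Finset.mem_filter.mpr ⟨by simpa using (hk c (Finset.mem_sdiff.mp hc).1).1, hker c hc⟩
  obtain ⟨φ, hφu, hφ⟩ := exists_linForm_prod hu κ hκ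
  set M := ∏ l ∈ Finset.univ.erase 0, linForm (b.coord l) ^ s l with hM
  have hMi : M ∈ vectorIdeal u ^ i := by
    rw [heq, hM, ← Finset.prod_pow_eq_pow_sum]
    refine Ideal.prod_mem_prod fun l hl => Ideal.pow_mem_pow (linForm_mem_vectorIdeal ?_) _
    simpa [← hb0, Finsupp.single_apply] using (Finset.ne_of_mem_erase hl).symm
  have hmon : coordEquiv b (monomial s (g.coeff s)) =
      C (g.coeff s) * (M * linForm (b.coord 0) ^ (d - i)) := by
    have hs0 : d - i = s 0 := by omega
    rw [monomial_eq, Finsupp.prod_fintype _ _ (by simp), hM, hs0,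
      Finset.prod_erase_mul _ (fun l => linForm (b.coord l) ^ s l) (Finset.mem_univ 0), map_mul,
      map_prod, ← algebraMap_eq, AlgEquiv.commutes]
    simp [coordEquiv_X]
  refine Submodule.mem_sup.mpr ⟨C (g.coeff s) * (M * ∏ t, linForm (φ t)), ⟨?_, ?_⟩,
    C (g.coeff s) * (M * (linForm (b.coord 0) ^ (d - i) - ∏ t, linForm (φ t))), ?_, ?_⟩
  · have h1 := (IsHomogeneous.prod (Finset.univ.erase 0) _ _ fun l _ =>
      (isHomogeneous_linForm (b.coord l)).pow (s l)).mul
        (IsHomogeneous.prod Finset.univ _ _ fun t _ => isHomogeneous_linForm (φ t))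
    have h2 := (isHomogeneous_C (Fin (n + 1)) (g.coeff s)).mul h1
    have h3 : 0 + (∑ l ∈ Finset.univ.erase 0, 1 * s l + ∑ _t : Fin (d - i), 1) = d := by
      simp
      omega
    rwa [h3] at h2
  · refine Ideal.mul_mem_left _ _ ?_
    simp only [vectorsIdeal, Submodule.mem_iInf]
    intro j hj
    refine Ideal.pow_le_pow_right (by omega : w j ≤ κ j + (w j - κ j)) ?_
    rw [pow_add]
    refine Ideal.mul_mem_mul ?_ (hφ j hj)
    exact Ideal.prod_mem_pow_sum_filter _ _ _ _ _ fun l _ hl =>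
      Ideal.pow_mem_pow (linForm_mem_vectorIdeal hl) _
  · refine Ideal.mul_mem_left _ _ ?_
    rw [pow_succ]
    exact Ideal.mul_mem_mul hMi (prod_linForm_sub_pow_mem φ _ fun t => by rw [hφu, ← hb0]; simp)
  · rw [hmon]
    ring

end Approximation

section HilbertFunction

variable {K : Type*} [Field K] {n : ℕ}

instance finite_homogeneousSubmodule (d : ℕ) :
    Module.Finite K (homogeneousSubmodule (Fin (n + 1)) K d) :=
  Module.Finite.iff_fg.mpr (homogeneousSubmodule_fg _ _ d)

theorem hilbDim_add_finrank_inf (I : Ideal (MvPolynomial (Fin (n + 1)) K)) (d : ℕ) :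
    hilbDim I d + finrank K
      (homogeneousSubmodule (Fin (n + 1)) K d ⊓ I.restrictScalars K : Submodule K _) =
        finrank K (homogeneousSubmodule (Fin (n + 1)) K d) := by
  have h := ((Ideal.Quotient.mkₐ K I).toLinearMap.domRestrict
    (homogeneousSubmodule (Fin (n + 1)) K d)).finrank_range_add_finrank_ker
  have hker : LinearMap.ker (Ideal.Quotient.mkₐ K I).toLinearMap = I.restrictScalars K := by
    ext f
    simp [Ideal.Quotient.eq_zero_iff_mem]
  rw [LinearMap.range_domRestrict, LinearMap.ker_domRestrict, hker] at h
  rw [hilbDim, ← h, ← Submodule.map_comap_subtype, Submodule.finrank_map_subtype_eq]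

theorem hilbDim_inf {I J : Ideal (MvPolynomial (Fin (n + 1)) K)} {d : ℕ}
    (h : homogeneousSubmodule (Fin (n + 1)) K d ≤
      homogeneousSubmodule (Fin (n + 1)) K d ⊓ I.restrictScalars K ⊔ J.restrictScalars K) :
    hilbDim (I ⊓ J) d = hilbDim I d + hilbDim J d := by
  have h1 := hilbDim_add_finrank_inf I d
  have h2 := hilbDim_add_finrank_inf J d
  have h3 := hilbDim_add_finrank_inf (I ⊓ J) d
  set H := homogeneousSubmodule (Fin (n + 1)) K d
  have fin (N : Submodule K (MvPolynomial (Fin (n + 1)) K)) :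
      FiniteDimensional K (H ⊓ N : Submodule K _) := Submodule.finiteDimensional_inf_left _ _
  have hsup : H ⊓ I.restrictScalars K ⊔ H ⊓ J.restrictScalars K = H := by
    refine le_antisymm (sup_le inf_le_left inf_le_left) ?_
    calc H ≤ (H ⊓ I.restrictScalars K ⊔ J.restrictScalars K) ⊓ H := le_inf h le_rfl
      _ = H ⊓ I.restrictScalars K ⊔ H ⊓ J.restrictScalars K := by
        rw [sup_inf_assoc_of_le _ inf_le_left, inf_comm (J.restrictScalars K)]
  have h0 := Submodule.finrank_sup_add_finrank_inf_eq (H ⊓ I.restrictScalars K)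
    (H ⊓ J.restrictScalars K)
  have hinf : H ⊓ I.restrictScalars K ⊓ (H ⊓ J.restrictScalars K) =
      H ⊓ (I ⊓ J).restrictScalars K := by
    ext f
    simp
    tauto
  rw [hsup, hinf] at h0
  omega

theorem hilbDim_top (d : ℕ) : hilbDim (⊤ : Ideal (MvPolynomial (Fin (n + 1)) K)) d = 0 := by
  have h := hilbDim_add_finrank_inf (⊤ : Ideal (MvPolynomial (Fin (n + 1)) K)) d
  rw [Submodule.restrictScalars_top, inf_top_eq] at h
  omega

theorem ncard_degree_eq_sum_erase_lt {m d : ℕ} (hm : 1 ≤ m) (hmd : m ≤ d + 1) :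
    {s : Fin (n + 1) →₀ ℕ | s.degree = d ∧ ∑ k ∈ Finset.univ.erase 0, s k < m}.ncard =
      (n + m - 1).choose n := by
  have himage : {s : Fin (n + 1) →₀ ℕ | s.degree = d ∧ ∑ k ∈ Finset.univ.erase 0, s k < m} =
      (· + Finsupp.single 0 (d + 1 - m)) ''
        ((Finset.univ.finsuppAntidiag (m - 1) : Finset (Fin (n + 1) →₀ ℕ)) : Set _) := by
    ext s
    have hs := sum_erase_zero_add s
    simp only [Set.mem_ofPred_eq, Set.mem_image, Finset.mem_coe, Finset.mem_finsuppAntidiag,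
      Finset.subset_univ, and_true]
    constructor
    · rintro ⟨h1, h2⟩
      have hle : Finsupp.single 0 (d + 1 - m) ≤ s := by
        rw [Finsupp.single_le_iff]
        omega
      refine ⟨s - Finsupp.single 0 (d + 1 - m), ?_, tsub_add_cancel_of_le hle⟩
      have h3 := congrArg Finsupp.degree (tsub_add_cancel_of_le hle)
      rw [map_add, Finsupp.degree_single, Finsupp.degree_eq_sum] at h3
      change ∑ k, (s - Finsupp.single 0 (d + 1 - m) : Fin (n + 1) →₀ ℕ) k = m - 1
      omega
    · rintro ⟨t, ht, rfl⟩
      rw [map_add, Finsupp.degree_single, Finsupp.degree_eq_sum]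
      change ∑ k, t k = m - 1 at ht
      rw [ht]
      refine ⟨by omega, ?_⟩
      have h1 := sum_erase_zero_add t
      rw [Finsupp.degree_eq_sum, ht] at h1
      have h2 : ∑ k ∈ (Finset.univ : Finset (Fin (n + 1))).erase 0,
          (t + Finsupp.single 0 (d + 1 - m) : Fin (n + 1) →₀ ℕ) k =
          ∑ k ∈ Finset.univ.erase 0, t k := Finset.sum_congr rfl fun k hk => by
        simp [(Finset.ne_of_mem_erase hk).symm]
      omega
  rw [himage, Set.ncard_image_of_injective _ (add_left_injective _), Set.ncard_coe_finset,
    Finset.card_finsuppAntidiag_nat_eq_choose, Finset.card_univ, Fintype.card_fin]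
  obtain ⟨c, rfl⟩ := Nat.exists_eq_add_of_le' hm
  simp only [Nat.add_sub_cancel, Nat.add_right_comm n 1 c]
  exact Nat.choose_symm_add.symm

theorem hilbDim_coordIdeal_pow {m d : ℕ} (hm : 1 ≤ m) (hmd : m ≤ d + 1) :
    hilbDim (coordIdeal K n ^ m) d = (n + m - 1).choose n := by
  let T := {s : Fin (n + 1) →₀ ℕ | s.degree = d ∧ ∑ k ∈ Finset.univ.erase 0, s k < m}
  set π := (Ideal.Quotient.mkₐ K (coordIdeal K n ^ m)).toLinearMap with hπ
  have hker (f) : π f = 0 ↔ f ∈ coordIdeal K n ^ m := by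
    simp [hπ, Ideal.Quotient.eq_zero_iff_mem]
  have hmap : (homogeneousSubmodule (Fin (n + 1)) K d).map π = (restrictSupport K T).map π := by
    refine le_antisymm ?_ (Submodule.map_mono fun f hf => ?_)
    · rw [Submodule.map_le_iff_le_comap]
      intro f hf
      rw [f.as_sum]
      refine Submodule.sum_mem _ fun s hs => ?_
      have hsd : s.degree = d := by
        rw [Finsupp.degree_eq_weight_one]
        exact hf (mem_support_iff.mp hs)
      by_cases hsm : ∑ k ∈ Finset.univ.erase 0, s k < m
      · exact Submodule.mem_map_of_mem
          ((monomial_mem_restrictSupport K).mpr (Or.inl ⟨hsd, hsm⟩))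
      · rw [Submodule.mem_comap, (hker _).mpr (monomial_mem_coordIdeal_pow (not_lt.mp hsm) _)]
        exact zero_mem _
    · intro s hs
      refine (DFunLike.congr_fun Finsupp.degree_eq_weight_one s).symm.trans ?_
      exact ((mem_restrictSupport_iff K).mp hf (mem_support_iff.mpr hs)).1
  have hinj : Function.Injective (π.domRestrict (restrictSupport K T)) := by
    rw [← LinearMap.ker_eq_bot, LinearMap.ker_eq_bot']
    rintro ⟨f, hf⟩ h0
    have hmem := mem_coordIdeal_pow_iff.mp ((hker f).mp h0)
    rw [Subtype.ext_iff]
    refine support_eq_empty.mp (Finset.eq_empty_of_forall_notMem fun s hs => ?_)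
    exact (((mem_restrictSupport_iff K).mp hf hs).2).not_ge (hmem s hs)
  rw [hilbDim, ← hπ, hmap, ← LinearMap.range_domRestrict, LinearMap.finrank_range_of_inj hinj,
    finrank_eq_nat_card_basis (basisRestrictSupport K T), Nat.card_coe_set_eq,
    ncard_degree_eq_sum_erase_lt hm hmd]

theorem hilbDim_vectorIdeal_pow {u : Fin (n + 1) → K} (hu : u ≠ 0) {m d : ℕ} (hm : 1 ≤ m)
    (hmd : m ≤ d + 1) : hilbDim (vectorIdeal u ^ m) d = (n + m - 1).choose n := by
  obtain ⟨b, -, rfl, -⟩ := exists_basis_of_card_le_relRank (K := K) (n := n) (by simp) hu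
    (v := fun _ : Empty => 0) (B := ∅) (by simp)
  rw [← hilbDim_coordIdeal_pow (K := K) hm hmd]
  have h1 := hilbDim_add_finrank_inf (vectorIdeal (b 0) ^ m) d
  have h2 := hilbDim_add_finrank_inf (coordIdeal K n ^ m) d
  have h3 : (homogeneousSubmodule (Fin (n + 1)) K d ⊓
      (coordIdeal K n ^ m).restrictScalars K).map (coordEquiv b).toLinearEquiv.toLinearMap =
      homogeneousSubmodule (Fin (n + 1)) K d ⊓ (vectorIdeal (b 0) ^ m).restrictScalars K := by
    ext f
    constructor
    · rintro ⟨g, ⟨hgd, hgm⟩, rfl⟩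
      refine ⟨isHomogeneous_coordEquiv b hgd, ?_⟩
      rw [← map_coordEquiv_coordIdeal_pow]
      exact Ideal.mem_map_of_mem _ hgm
    · rintro ⟨hfd, hfm⟩
      exact ⟨(coordEquiv b).symm f, ⟨isHomogeneous_coordEquiv_symm b hfd,
        (coordEquiv_symm_mem_iff b).mpr hfm⟩, by simp⟩
  have h4 := LinearEquiv.finrank_map_eq (coordEquiv b).toLinearEquiv
    (homogeneousSubmodule (Fin (n + 1)) K d ⊓ (coordIdeal K n ^ m).restrictScalars K)
  rw [h3] at h4
  omega

end HilbertFunction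

section IndependentConditions

variable {K : Type*} [Field K] {n : ℕ} {ι : Type*} [DecidableEq ι]

theorem homogeneousSubmodule_le_sup_vectorIdeal_pow {u : Fin (n + 1) → K} (hu : u ≠ 0)
    {v : ι → Fin (n + 1) → K} {Q : Finset ι} {w : ι → ℕ} {d M : ℕ}
    (h : ∀ i < M, SegreCondition (relRank (K := K) u v) Q w d i) :
    homogeneousSubmodule (Fin (n + 1)) K d ≤
      homogeneousSubmodule (Fin (n + 1)) K d ⊓ (vectorsIdeal v w Q).restrictScalars K ⊔
        (vectorIdeal u ^ M).restrictScalars K := by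
  induction M with
  | zero => simp
  | succ M ih =>
    intro f hf
    obtain ⟨g, hg, e, he, rfl⟩ := Submodule.mem_sup.mp (ih (fun i hi => h i (by omega)) hf)
    have hed : e ∈ homogeneousSubmodule (Fin (n + 1)) K d := by simpa using sub_mem hf hg.1
    exact add_mem (Submodule.mem_sup_left hg)
      (homogeneous_inf_vectorIdeal_pow_le hu (h M (by omega)) ⟨hed, he⟩)

theorem hilbDim_vectorsIdeal {v : ι → Fin (n + 1) → K} (hv : ∀ j, v j ≠ 0) {m : ι → ℕ} {d : ℕ}
    (hm : ∀ j, 1 ≤ m j) (hmd : ∀ j, m j ≤ d + 1)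
    (hsegre : ∀ A : Finset ι, 2 ≤ A.card →
      ∑ j ∈ A, m j ≤ d * (finrank K (Submodule.span K (v '' (A : Set ι))) - 1) + 1)
    (hnull : ∀ A : Finset ι, A.card ≤ finrank K (Submodule.span K (v '' (A : Set ι))) + 2)
    (S : Finset ι) : hilbDim (vectorsIdeal v m S) d = ∑ j ∈ S, (n + m j - 1).choose n := by
  induction S using Finset.strongInduction with
  | H S ih =>
    obtain rfl | hS := S.eq_empty_or_nonempty
    · simp [vectorsIdeal, hilbDim_top]
    obtain ⟨p, hp, hmin⟩ := S.exists_min_image m hS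
    have hsplit : vectorsIdeal v m S = vectorsIdeal v m (S.erase p) ⊓ vectorIdeal (v p) ^ m p := by
      conv_lhs => rw [← Finset.insert_erase hp]
      rw [vectorsIdeal, Finset.iInf_insert, inf_comm, vectorsIdeal]
    have hrank (A : Finset ι) : finrank K (Submodule.span K (v '' (insert p A : Finset ι))) =
        relRank (K := K) (v p) v A + 1 := by
      rw [Finset.coe_insert, Set.image_insert_eq, finrank_span_insert_image (hv p)]
    have hcond (i : ℕ) (hi : i < m p) :
        SegreCondition (relRank (K := K) (v p) v) (S.erase p) m d i := by
      refine ⟨isRankFunction_relRank _ _,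
        fun j hj => hi.trans_le (hmin j (Finset.mem_of_mem_erase hj)), fun A hA hne => ?_,
        fun A hA => ?_⟩
      · have hpA : p ∉ A := fun h => Finset.notMem_erase p S (hA h)
        have h1 := hsegre (insert p A)
          (by rw [Finset.card_insert_of_notMem hpA]; have := hne.card_pos; omega)
        rw [hrank, Finset.sum_insert hpA, Nat.add_sub_cancel] at h1
        omega
      · have hpA : p ∉ A := fun h => Finset.notMem_erase p S (hA h)
        have h1 := hnull (insert p A)
        rw [hrank, Finset.card_insert_of_notMem hpA] at h1
        omega
    rw [hsplit, hilbDim_inf (homogeneousSubmodule_le_sup_vectorIdeal_pow (hv p) hcond),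
      ih _ (Finset.erase_ssubset hp), hilbDim_vectorIdeal_pow (hv p) (hm p) (hmd p),
      Finset.sum_erase_add _ _ hp]

end IndependentConditions

section SegreBound

variable {K : Type*} [Field K] {n : ℕ}

theorem two_le_finrank_span_rep {V ι : Type*} [AddCommGroup V] [Module K V]
    [FiniteDimensional K V] {p : ι → Projectivization K V} (hinj : Function.Injective p)
    {A : Finset ι} (hA : 2 ≤ A.card) :
    2 ≤ finrank K (Submodule.span K ((fun i => (p i).rep) '' (A : Set ι))) := by
  obtain ⟨a, ha, b, hb, hab⟩ := Finset.one_lt_card.mp hA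
  have hind : LinearIndependent K ![(p a).rep, (p b).rep] := by
    rw [LinearIndependent.pair_iff' (p a).rep_nonzero]
    intro c hc
    refine hab (hinj ?_)
    rw [← (p a).mk_rep, ← (p b).mk_rep, eq_comm, Projectivization.mk_eq_mk_iff']
    exact ⟨c, hc⟩
  refine (finrank_span_eq_card hind).symm.le.trans (Submodule.finrank_mono (Submodule.span_mono ?_))
  rintro _ ⟨k, rfl⟩
  fin_cases k
  · exact ⟨a, ha, rfl⟩
  · exact ⟨b, hb, rfl⟩

theorem sum_le_weightIn {s : ℕ} (p : Fin s → Projectivization K (Fin (n + 1) → K)) (m : Fin s → ℕ)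
    (A : Finset (Fin s)) :
    ∑ i ∈ A, m i ≤ weightIn p m
      (projSet (Submodule.span K ((fun i => (p i).rep) '' (A : Set (Fin s))))) := by
  classical
  rw [weightIn, ← Finset.sum_filter]
  refine Finset.sum_le_sum_of_subset fun i hi => ?_
  rw [Finset.mem_filter]
  exact ⟨Finset.mem_univ i, Submodule.subset_span ⟨i, hi, rfl⟩⟩

theorem weightIn_le_sum {s : ℕ} (p : Fin s → Projectivization K (Fin (n + 1) → K)) (m : Fin s → ℕ)
    (L : Set (Projectivization K (Fin (n + 1) → K))) : weightIn p m L ≤ ∑ i, m i := by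
  classical
  rw [weightIn, ← Finset.sum_filter]
  exact Finset.sum_le_sum_of_subset (Finset.filter_subset _ _)

theorem fatIdeal_eq_vectorsIdeal {s : ℕ} (p : Fin s → Projectivization K (Fin (n + 1) → K))
    (m : Fin s → ℕ) : fatIdeal p m = vectorsIdeal (fun i => (p i).rep) m Finset.univ := by
  simp [fatIdeal, vectorsIdeal, pointIdeal_eq_vectorIdeal]

end SegreBound

/-- **Generalised Segre bound for `n+3` points** (Theorem `segre for arbitrary n+3`).
If `Z = Σ_{i=1}^{n+3} m_i p_i` is a fat point scheme supported on a non-degenerate set of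
distinct points of `ℙⁿ`, then `reg(Z) ≤ max { ⌊(w_L(Z)+r−2)/r⌋ }`, the maximum running over
all `r`-dimensional linear subspaces `L ⊆ ℙⁿ` with `1 ≤ r ≤ n`.  (We formalise `reg(Z) ≤ max`
by exhibiting one subspace whose Segre quantity bounds `reg(Z)`.) -/
theorem generalized_segre_bound_n_plus_three {K : Type*} [Field K] [IsAlgClosed K]
    {n : ℕ} (hn : 1 ≤ n)
    (p : Fin (n + 3) → Projectivization K (Fin (n + 1) → K))
    (hinj : Function.Injective p)
    (hspan : Submodule.span K (Set.range fun i => (p i).rep) = ⊤)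
    (m : Fin (n + 3) → ℕ) (hm : ∀ i, 1 ≤ m i) :
    ∃ r : ℕ, 1 ≤ r ∧ r ≤ n ∧
      ∃ V : Submodule K (Fin (n + 1) → K), Module.finrank K V = r + 1 ∧
        regIndex p m ≤ (weightIn p m (projSet V) + r - 2) / r := by
  let v : Fin (n + 3) → Fin (n + 1) → K := fun i => (p i).rep
  let P : Set ℕ := {q | ∃ r : ℕ, 1 ≤ r ∧ r ≤ n ∧ ∃ V : Submodule K (Fin (n + 1) → K),
    finrank K V = r + 1 ∧ q = (weightIn p m (projSet V) + r - 2) / r}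
  have hne : P.Nonempty := ⟨_, n, hn, le_rfl, ⊤, by simp, rfl⟩
  have hbdd : BddAbove P := by
    refine ⟨∑ i, m i + n, ?_⟩
    rintro _ ⟨r, -, hr, V, -, rfl⟩
    have := weightIn_le_sum p m (projSet V)
    exact (Nat.div_le_self _ _).trans (by omega)
  set d := sSup P
  have hsegre (A : Finset (Fin (n + 3))) (hA : 2 ≤ A.card) :
      ∑ j ∈ A, m j ≤ d * (finrank K (Submodule.span K (v '' (A : Set (Fin (n + 3))))) - 1) + 1 := by
    have h1 : 2 ≤ finrank K (Submodule.span K (v '' (A : Set (Fin (n + 3))))) :=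
      two_le_finrank_span_rep hinj hA
    have h2 := Submodule.finrank_le (Submodule.span K (v '' (A : Set (Fin (n + 3)))))
    rw [finrank_fin_fun] at h2
    obtain ⟨r, hr⟩ := Nat.exists_eq_add_of_le' h1
    have h3 : (weightIn p m (projSet (Submodule.span K (v '' (A : Set (Fin (n + 3)))))) +
        (r + 1) - 2) / (r + 1) ≤ d :=
      le_csSup hbdd ⟨r + 1, by omega, by omega, _, hr, rfl⟩
    have h4 : ∑ j ∈ A, m j ≤
        weightIn p m (projSet (Submodule.span K (v '' (A : Set (Fin (n + 3)))))) :=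
      sum_le_weightIn p m A
    have h5 := Nat.lt_mul_of_div_lt (Nat.lt_succ_of_le h3) r.succ_pos
    rw [hr, show r + 2 - 1 = r + 1 from rfl]
    rw [Nat.succ_eq_add_one, add_mul, one_mul] at h5
    omega
  have hnull (A : Finset (Fin (n + 3))) :
      A.card ≤ finrank K (Submodule.span K (v '' (A : Set (Fin (n + 3))))) + 2 := by
    have h1 := (isRankFunction_finrank_span (K := K) v).le_add_card_sdiff A Finset.univ
    have h2 := Finset.card_sdiff_add_card_eq_card A.subset_univ
    have h3 : Submodule.span K (v '' ((Finset.univ : Finset (Fin (n + 3))) : Set _)) = ⊤ := by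
      rw [Finset.coe_univ, Set.image_univ, hspan]
    rw [h3, finrank_top, finrank_fin_fun] at h1
    rw [Finset.card_univ, Fintype.card_fin] at h2
    omega
  have hmd (j : Fin (n + 3)) : m j ≤ d + 1 := by
    obtain ⟨k, hk⟩ := exists_ne j
    have h1 := hsegre {j, k} (by rw [Finset.card_pair hk.symm])
    have h2 := (isRankFunction_finrank_span (K := K) v).le_card {j, k}
    rw [Finset.card_pair hk.symm] at h2
    rw [Finset.sum_pair hk.symm] at h1
    have h3 := Nat.mul_le_mul_left d (Nat.sub_le_sub_right h2 1)
    omega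
  obtain ⟨r, hr, hrn, V, hV, hdV⟩ := Nat.sSup_mem hne hbdd
  refine ⟨r, hr, hrn, V, hV, hdV ▸ Nat.sInf_le ?_⟩
  change hilbDim (fatIdeal p m) d = expDeg n m
  rw [fatIdeal_eq_vectorsIdeal]
  exact hilbDim_vectorsIdeal (fun j => (p j).rep_nonzero) hm hmd hsegre hnull Finset.univ
end

section
/- Fix integers n ≥ 2, m > 0, a > 0 and t ≥ a + m − 1. Let S ⊂ P^n be a finite set, o ∈ S, and H ⊂ P^n a hyperplane with o ∉ H. Let ℓ : P^n ∖ {o} → H be the linear projection from o (ℓ(p) is the intersection with H of the line through o and p). Set S' = S ∖ {o} and assume ℓ restricted to S' is injective. For each p ∈ S fix an integer m_p ≥ 0 with m_o = m and m_p ≤ a for every p ∈ S'; set Z = Σ_{p ∈ S, m_p > 0} m_p p. For each integer x ≥ 0 let W_x = Σ_{p ∈ S'} max{0, m_p − x}·ℓ(p), a fat point scheme in H regarded as a projective (n−1)-space (W_x is empty for x ≥ a, and h^1 of the empty scheme is 0). If h^1(H, I_{W_x}(t − x)) = 0 for all x = 0,…,a, then h^1(I_Z(t)) = 0. -/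
open MvPolynomial Module

variable {K : Type*} [Field K]

/-- `h¹(P(W), I_W(d)) = 0` for a fat point scheme supported on points of the linear
subspace `P(W) ⊆ ℙⁿ`, with `P(W) ≅ ℙᵏ`: for every linear identification
`e : Kᵏ⁺¹ ≃ W`, the fat point scheme obtained by transporting the points (with positive
multiplicity) to `ℙᵏ` imposes independent conditions on degree-`d` forms.  (This does not
depend on the chosen identification.) -/
def H1ZeroIn {n : ℕ} (k : ℕ) {s : ℕ} (W : Submodule K (Fin (n + 1) → K))
    (p : Fin s → Projectivization K (Fin (n + 1) → K)) (m : Fin s → ℕ) (d : ℕ) : Prop :=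
  ∀ e : (Fin (k + 1) → K) ≃ₗ[K] W,
    ∃ q : Fin s → Projectivization K (Fin (k + 1) → K),
      (∀ i, m i ≠ 0 →
        Projectivization.map (W.subtype ∘ₗ (e : (Fin (k + 1) → K) →ₗ[K] W))
          (W.injective_subtype.comp e.injective) (q i) = p i) ∧
      H1Zero q m d

/-- The algebra map `K[X₀,…,X_N] → K[T₀,…,T_{N-1}]` sending a polynomial `F` to its restriction
`F (b₀ + Σ Tₖ bₖ₊₁)` to an affine chart centred at the point spanned by the vector `b₀`. -/
noncomputable def localMap {N : ℕ} (b : Fin (N + 1) → Fin (N + 1) → K) :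
    MvPolynomial (Fin (N + 1)) K →ₐ[K] MvPolynomial (Fin N) K :=
  aeval fun j => C (b 0 j) + ∑ k : Fin N, C (b k.succ j) * X k

theorem sum_C_mul_X_mem_pointIdeal {N : ℕ} {p : Projectivization K (Fin (N + 1) → K)}
    {c : Fin (N + 1) → K} (hc : ∑ i, c i * p.rep i = 0) :
    ∑ i, C (c i) * X i ∈ pointIdeal p :=
  Ideal.subset_span ⟨c, hc, rfl⟩

theorem localMap_sum_C_mul_X {N : ℕ} (b : Fin (N + 1) → Fin (N + 1) → K)
    (c : Fin (N + 1) → K) :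
    localMap b (∑ j, C (c j) * X j) =
      C (∑ j, c j * b 0 j) + ∑ k : Fin N, C (∑ j, c j * b k.succ j) * X k := by
  simp only [localMap, map_sum, map_mul, algHom_C, aeval_X, mul_add, Finset.sum_add_distrib,
    Finset.mul_sum, Finset.sum_mul, algebraMap_eq]
  rw [Finset.sum_comm]
  simp only [mul_assoc]

theorem localMap_mem_pow {N m : ℕ} {p : Projectivization K (Fin (N + 1) → K)}
    {b : Fin (N + 1) → Fin (N + 1) → K} {c : K} (hb : b 0 = c • p.rep)
    {F : MvPolynomial (Fin (N + 1)) K} (hF : F ∈ pointIdeal p ^ m) :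
    localMap b F ∈ idealOfVars (Fin N) K ^ m := by
  have h1 : (pointIdeal p).map (localMap b) ≤ idealOfVars (Fin N) K := by
    rw [pointIdeal, Ideal.map_span, Ideal.span_le]
    rintro _ ⟨_, ⟨a, ha, rfl⟩, rfl⟩
    rw [localMap_sum_C_mul_X]
    have : ∑ j, a j * b 0 j = 0 := by
      simp only [hb, Pi.smul_apply, smul_eq_mul, mul_left_comm _ c, ← Finset.mul_sum, ha, mul_zero]
    rw [this, C_0, zero_add]
    exact Ideal.sum_mem _ fun k _ => Ideal.mul_mem_left _ _ (Ideal.subset_span ⟨k, rfl⟩)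
  have h2 := Ideal.mem_map_of_mem (localMap b) hF
  rw [Ideal.map_pow] at h2
  exact Ideal.pow_right_mono h1 m h2

theorem aeval_cons_one_X_monomial {N : ℕ} (e : Fin (N + 1) →₀ ℕ) (c : K) :
    aeval (Fin.cons 1 X : Fin (N + 1) → MvPolynomial (Fin N) K) (monomial e c) =
      monomial e.tail c := by
  rw [aeval_monomial, monomial_eq, Finsupp.prod_fintype _ _ (by simp),
    Finsupp.prod_fintype _ _ (by simp), Fin.prod_univ_succ]
  simp [Finsupp.tail_apply, algebraMap_eq]

theorem degree_eq_add_degree_tail {N : ℕ} (e : Fin (N + 1) →₀ ℕ) :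
    e.degree = e 0 + e.tail.degree := by
  simp [Finsupp.degree_eq_sum, Fin.sum_univ_succ, Finsupp.tail_apply]

theorem coeff_tail_aeval_cons_one_X {N d : ℕ} {G : MvPolynomial (Fin (N + 1)) K}
    (hG : G.IsHomogeneous d) {e : Fin (N + 1) →₀ ℕ} (he : e.degree = d) :
    coeff e.tail (aeval (Fin.cons 1 X : Fin (N + 1) → MvPolynomial (Fin N) K) G) =
      coeff e G := by
  classical
  conv_lhs => rw [G.as_sum]
  simp only [map_sum, aeval_cons_one_X_monomial, coeff_sum, coeff_monomial]
  rw [Finset.sum_eq_single e]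
  · simp
  · intro e' he' hne
    refine if_neg fun ht => hne ?_
    have h1 : e'.degree = d := by
      rw [Finsupp.degree_eq_weight_one]
      exact hG (mem_support_iff.mp he')
    rw [degree_eq_add_degree_tail] at he h1
    rw [← Finsupp.cons_tail e, ← Finsupp.cons_tail e', ht]
    congr 1
    rw [ht] at h1
    omega
  · intro h
    simpa using h

theorem aeval_mem_pow_of_aeval_cons_one_X_mem {N d m : ℕ} {A : Type*} [CommRing A] [Algebra K A]
    {I : Ideal A} {β : Fin (N + 1) → A} (hβ : ∀ k : Fin N, β k.succ ∈ I)
    {G : MvPolynomial (Fin (N + 1)) K} (hG : G.IsHomogeneous d)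
    (h : aeval (Fin.cons 1 X : Fin (N + 1) → MvPolynomial (Fin N) K) G ∈
      idealOfVars (Fin N) K ^ m) :
    aeval β G ∈ I ^ m := by
  rw [G.as_sum, map_sum]
  refine Ideal.sum_mem _ fun e he => ?_
  have hd : e.degree = d := by
    rw [Finsupp.degree_eq_weight_one]
    exact hG (mem_support_iff.mp he)
  have hm : m ≤ e.tail.degree := by
    by_contra! hlt
    rw [mem_pow_idealOfVars_iff'] at h
    exact mem_support_iff.mp he ((coeff_tail_aeval_cons_one_X hG hd).symm.trans (h _ hlt))
  rw [aeval_monomial, Finsupp.prod_fintype _ _ (by simp), Fin.prod_univ_succ]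
  refine Ideal.mul_mem_left _ _ (Ideal.mul_mem_left _ _ (Ideal.pow_le_pow_right hm ?_))
  rw [Finsupp.degree_eq_sum, ← Finset.prod_pow_eq_pow_sum]
  exact Ideal.prod_mem_prod fun k _ => Ideal.pow_mem_pow (hβ k) _

theorem mem_pow_pointIdeal_of_localMap_mem {N d m : ℕ}
    {p : Projectivization K (Fin (N + 1) → K)}
    {b : Fin (N + 1) → Fin (N + 1) → K} (hli : LinearIndependent K b) {c : K} (hc : c ≠ 0)
    (hb : b 0 = c • p.rep) {F : MvPolynomial (Fin (N + 1)) K} (hF : F.IsHomogeneous d)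
    (h : localMap b F ∈ idealOfVars (Fin N) K ^ m) :
    F ∈ pointIdeal p ^ m := by
  let B : Matrix (Fin (N + 1)) (Fin (N + 1)) K := Matrix.of b
  have hB : IsUnit B.det := (Matrix.isUnit_iff_isUnit_det B).mp
    (Matrix.linearIndependent_rows_iff_isUnit.mp hli)
  let β : Fin (N + 1) → MvPolynomial (Fin (N + 1)) K := fun k => ∑ j, C (B⁻¹ j k) * X j
  let σ : MvPolynomial (Fin (N + 1)) K →ₐ[K] MvPolynomial (Fin (N + 1)) K :=
    aeval fun j => ∑ k, C (b k j) * X k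
  have hσ : aeval β (σ F) = F := by
    have : (aeval β).comp σ = AlgHom.id K _ := by
      ext1 j
      simp only [AlgHom.comp_apply, σ, aeval_X, map_sum, map_mul, algHom_C, β, AlgHom.id_apply,
        Finset.mul_sum, algebraMap_eq]
      rw [Finset.sum_comm]
      have hinv : ∀ i, ∑ k, b k j * B⁻¹ i k = if i = j then 1 else 0 := fun i => by
        have := congrFun (congrFun (Matrix.nonsing_inv_mul B hB) i) j
        rw [Matrix.mul_apply, Matrix.one_apply] at this
        simpa [B, mul_comm] using this
      simp only [← mul_assoc, ← C_mul, ← Finset.sum_mul, ← map_sum, hinv]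
      simp
    exact congrArg (fun f => f F) this
  have hβ : ∀ k : Fin N, β k.succ ∈ pointIdeal p := fun k => by
    refine sum_C_mul_X_mem_pointIdeal ?_
    have := congrFun (congrFun (Matrix.mul_nonsing_inv B hB) 0) k.succ
    rw [Matrix.mul_apply, Matrix.one_apply_ne (Fin.succ_ne_zero k).symm] at this
    simp only [B, Matrix.of_apply, hb, Pi.smul_apply, smul_eq_mul, mul_assoc,
      ← Finset.mul_sum] at this
    simpa [B, mul_comm] using (mul_eq_zero.mp this).resolve_left hc
  have hσF : (σ F).IsHomogeneous d := by
    simpa only [one_mul] using hF.aeval (n := 1) (fun j => ∑ k, C (b k j) * X k)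
      fun j => IsHomogeneous.sum _ _ _ fun k _ => isHomogeneous_C_mul_X _ _
  rw [← hσ]
  refine aeval_mem_pow_of_aeval_cons_one_X_mem hβ hσF ?_
  have : (aeval (Fin.cons 1 X : Fin (N + 1) → MvPolynomial (Fin N) K)).comp σ = localMap b := by
    ext1 j
    simp [σ, localMap, Fin.sum_univ_succ, algebraMap_eq]
  rwa [← AlgHom.comp_apply, this]

theorem card_degree_lt {N : ℕ} (hN : 1 ≤ N) (m : ℕ) :
    Nat.card {u : Fin N →₀ ℕ // u.degree < m} = (N + m - 1).choose N := by
  classical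
  obtain ⟨N, rfl⟩ := Nat.exists_eq_add_of_le' hN
  have h : ∀ u : Fin (N + 1) →₀ ℕ, u ∈ (Finset.range m).biUnion
      (fun j => Finset.finsuppAntidiag Finset.univ j) ↔ u.degree < m := fun u => by
    simp [Finset.mem_finsuppAntidiag, Finsupp.degree_eq_sum]
  rw [← Nat.card_congr (Equiv.subtypeEquivRight h), Nat.card_eq_fintype_card, Fintype.card_coe,
    Finset.card_biUnion]
  · simp only [Finset.card_finsuppAntidiag_nat_eq_choose, Finset.card_univ, Fintype.card_fin]
    induction m with
    | zero => simp
    | succ m ih =>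
      rw [Finset.sum_range_succ, ih (fun u => by
        simp [Finset.mem_finsuppAntidiag, Finsupp.degree_eq_sum])]
      have e1 : N + 1 + m - 1 = N + m := by omega
      have e2 : N + 1 + (m + 1) - 1 = N + m + 1 := by omega
      rw [e1, e2, Nat.choose_succ_succ, Nat.choose_symm_add, add_comm]
  · intro i _ j _ hij
    rw [Function.onFun, Finset.disjoint_left]
    intro u hu hu'
    rw [Finset.mem_finsuppAntidiag] at hu hu'
    exact hij (hu.1.symm.trans hu'.1)

/-- Independence of conditions, read off in affine charts: the fat point scheme imposes
independent conditions on forms of degree `d` iff every tuple of jets is induced by such a form. -/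
theorem h1Zero_iff_surjective {N s : ℕ} (hN : 1 ≤ N)
    {p : Fin s → Projectivization K (Fin (N + 1) → K)} {m : Fin s → ℕ} {d : ℕ}
    {b : Fin s → Fin (N + 1) → Fin (N + 1) → K} (hli : ∀ i, LinearIndependent K (b i))
    (hb : ∀ i, ∃ c : K, c ≠ 0 ∧ b i 0 = c • (p i).rep) :
    H1Zero p m d ↔ ∀ g : Fin s → MvPolynomial (Fin N) K,
      ∃ F : MvPolynomial (Fin (N + 1)) K, F.IsHomogeneous d ∧
        ∀ i, localMap (b i) F - g i ∈ idealOfVars (Fin N) K ^ m i := by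
  have hfin : ∀ i, Finite {u : Fin N →₀ ℕ // u.degree < m i} :=
    fun i => Finsupp.finite_of_degree_lt (m i)
  have := fun i => Fintype.ofFinite {u : Fin N →₀ ℕ // u.degree < m i}
  let V := homogeneousSubmodule (Fin (N + 1)) K d
  let T := (Σ i, {u : Fin N →₀ ℕ // u.degree < m i}) → K
  let Φ : MvPolynomial (Fin (N + 1)) K →ₗ[K] T :=
    LinearMap.pi fun x => lcoeff K x.2.1 ∘ₗ (localMap (b x.1)).toLinearMap
  let f := (Ideal.Quotient.mkₐ K (fatIdeal p m)).toLinearMap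
  have hΦ : ∀ F G, Φ F = Φ G ↔ ∀ i, localMap (b i) F - localMap (b i) G ∈
      idealOfVars (Fin N) K ^ m i := fun F G => by
    simp only [mem_pow_idealOfVars_iff', coeff_sub, sub_eq_zero]
    constructor
    · exact fun h i u hu => congrFun h ⟨i, u, hu⟩
    · exact fun h => funext fun x => h x.1 x.2.1 x.2.2
  have hker : LinearMap.ker (f.domRestrict V) = LinearMap.ker (Φ.domRestrict V) := by
    ext ⟨F, hF⟩
    simp only [LinearMap.mem_ker, LinearMap.domRestrict_apply]
    have h0 := hΦ F 0
    simp only [map_zero, sub_zero] at h0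
    rw [h0]
    change Ideal.Quotient.mk _ F = 0 ↔ _
    rw [Ideal.Quotient.eq_zero_iff_mem, fatIdeal, Ideal.mem_iInf]
    refine forall_congr' fun i => ?_
    obtain ⟨c, hc, hbc⟩ := hb i
    exact ⟨localMap_mem_pow hbc, mem_pow_pointIdeal_of_localMap_mem (hli i) hc hbc hF⟩
  have hrank : hilbDim (fatIdeal p m) d = finrank K (LinearMap.range (Φ.domRestrict V)) := by
    have h1 : V.map f = LinearMap.range (f.domRestrict V) := by
      rw [LinearMap.range_domRestrict]
    change finrank K (V.map f) = _
    rw [h1, ← (f.domRestrict V).quotKerEquivRange.finrank_eq,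
      ← (Φ.domRestrict V).quotKerEquivRange.finrank_eq, hker]
  have hT : finrank K T = expDeg N m := by
    rw [Module.finrank_fintype_fun_eq_card, Fintype.card_sigma]
    exact Finset.sum_congr rfl fun i _ => by
      rw [← Nat.card_eq_fintype_card, card_degree_lt hN]
  have hsurj : H1Zero p m d ↔ Function.Surjective (Φ.domRestrict V) := by
    rw [H1Zero, hrank, ← hT, ← LinearMap.range_eq_top]
    exact ⟨Submodule.eq_top_of_finrank_eq, fun h => by rw [h, finrank_top]⟩
  rw [hsurj]
  constructor
  · intro h g
    obtain ⟨⟨F, hF⟩, hFg⟩ := h fun x => coeff x.2.1 (g x.1)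
    refine ⟨F, hF, fun i => (mem_pow_idealOfVars_iff' _ _).mpr fun u hu => ?_⟩
    rw [coeff_sub, sub_eq_zero]
    exact congrFun hFg ⟨i, u, hu⟩
  · intro h y
    obtain ⟨F, hF, hFg⟩ := h fun i => ∑ u : {u : Fin N →₀ ℕ // u.degree < m i},
      monomial u.1 (y ⟨i, u⟩)
    refine ⟨⟨F, hF⟩, funext fun ⟨i, u⟩ => ?_⟩
    have := (mem_pow_idealOfVars_iff' _ _).mp (hFg i) u.1 u.2
    rw [coeff_sub, sub_eq_zero] at this
    refine this.trans ?_
    classical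
    simp [coeff_sum, coeff_monomial, ← Subtype.ext_iff]

theorem MvPolynomial.IsHomogeneous.mem_pow_idealOfVars {N d m : ℕ} {f : MvPolynomial (Fin N) K}
    (hf : f.IsHomogeneous d) (hmd : m ≤ d) : f ∈ idealOfVars (Fin N) K ^ m := by
  rw [mem_pow_idealOfVars_iff]
  intro u hu
  refine hmd.trans_eq (Eq.symm ?_)
  rw [Finsupp.degree_eq_weight_one]
  exact hf (mem_support_iff.mp hu)

theorem rename_succ_mem_pow_idealOfVars {N m : ℕ} {f : MvPolynomial (Fin N) K}
    (hf : f ∈ idealOfVars (Fin N) K ^ m) :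
    rename Fin.succ f ∈ idealOfVars (Fin (N + 1)) K ^ m := by
  have h1 : (idealOfVars (Fin N) K).map (rename Fin.succ : MvPolynomial (Fin N) K →ₐ[K] _) ≤
      idealOfVars (Fin (N + 1)) K := by
    rw [Ideal.map_span, Ideal.span_le]
    rintro _ ⟨_, ⟨k, rfl⟩, rfl⟩
    rw [rename_X]
    exact Ideal.subset_span ⟨_, rfl⟩
  have h2 := Ideal.mem_map_of_mem (rename Fin.succ : MvPolynomial (Fin N) K →ₐ[K] _) hf
  rw [Ideal.map_pow] at h2
  exact Ideal.pow_right_mono h1 m h2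

theorem exists_eq_rename_succ_add_X_mul {N : ℕ} (g : MvPolynomial (Fin (N + 1)) K) :
    ∃ (g₀ : MvPolynomial (Fin N) K) (r : MvPolynomial (Fin (N + 1)) K),
      g = rename Fin.succ g₀ + X 0 * r := by
  induction g using MvPolynomial.induction_on with
  | C a => exact ⟨C a, 0, by simp⟩
  | add f g hf hg =>
    obtain ⟨f₀, r, hf⟩ := hf
    obtain ⟨g₀, r', hg⟩ := hg
    refine ⟨f₀ + g₀, r + r', ?_⟩
    rw [map_add, hf, hg]
    ring
  | mul_X g i hg =>
    obtain ⟨g₀, r, hg⟩ := hg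
    refine Fin.cases ⟨0, g, by rw [map_zero]; ring⟩ (fun k => ⟨g₀ * X k, r * X k.succ, ?_⟩) i
    rw [map_mul, rename_X, hg]
    ring

theorem exists_sub_sum_X_zero_pow_mul_rename_mem {N : ℕ} (g : MvPolynomial (Fin (N + 1)) K)
    (a : ℕ) : ∃ c : ℕ → MvPolynomial (Fin N) K,
      g - ∑ j ∈ Finset.range a, X 0 ^ j * rename Fin.succ (c j) ∈
        idealOfVars (Fin (N + 1)) K ^ a := by
  choose φ r h using exists_eq_rename_succ_add_X_mul (K := K) (N := N)
  have key : g - ∑ j ∈ Finset.range a, X 0 ^ j * rename Fin.succ (φ (r^[j] g)) =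
      X 0 ^ a * r^[a] g := by
    induction a with
    | zero => simp
    | succ a ih =>
      rw [Finset.sum_range_succ, ← sub_sub, ih, Function.iterate_succ_apply']
      nth_rw 1 [h (r^[a] g)]
      ring
  refine ⟨fun j => φ (r^[j] g), ?_⟩
  rw [key]
  exact Ideal.mul_mem_right _ _ (Ideal.pow_mem_pow (Ideal.subset_span (Set.mem_range_self 0)) a)

/-- The linear form, as a polynomial, attached to a linear functional on `K^M`. -/
noncomputable def linearForm {M : ℕ} (l : (Fin M → K) →ₗ[K] K) : MvPolynomial (Fin M) K :=
  ∑ j, C (l (Pi.single j 1)) * X j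

theorem linearForm_isHomogeneous {M : ℕ} (l : (Fin M → K) →ₗ[K] K) :
    (linearForm l).IsHomogeneous 1 :=
  IsHomogeneous.sum _ _ _ fun _ _ => isHomogeneous_C_mul_X _ _

theorem localMap_linearForm {N : ℕ} (b : Fin (N + 1) → Fin (N + 1) → K)
    (l : (Fin (N + 1) → K) →ₗ[K] K) :
    localMap b (linearForm l) = C (l (b 0)) + ∑ k : Fin N, C (l (b k.succ)) * X k := by
  have h : ∀ v : Fin (N + 1) → K, ∑ j, l (Pi.single j 1) * v j = l v := fun v => by
    conv_rhs => rw [← Finset.univ_sum_single v, map_sum]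
    refine Finset.sum_congr rfl fun j _ => ?_
    rw [mul_comm, ← smul_eq_mul, ← map_smul, ← Pi.single_smul, smul_eq_mul, mul_one]
  rw [linearForm, localMap_sum_C_mul_X]
  simp only [h]

/-- Pullback of polynomials along a linear map `K^M → K^L`. -/
noncomputable def pullback {M L : ℕ} (π : (Fin M → K) →ₗ[K] (Fin L → K)) :
    MvPolynomial (Fin L) K →ₐ[K] MvPolynomial (Fin M) K :=
  aeval fun i => linearForm (LinearMap.proj i ∘ₗ π)

theorem MvPolynomial.IsHomogeneous.pullback {M L d : ℕ} (π : (Fin M → K) →ₗ[K] (Fin L → K))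
    {f : MvPolynomial (Fin L) K} (hf : f.IsHomogeneous d) :
    (_root_.pullback π f).IsHomogeneous d := by
  simpa only [one_mul] using! hf.aeval (n := 1) _ fun i => linearForm_isHomogeneous _

section Cone

variable {N : ℕ} {e : (Fin (N + 1) → K) →ₗ[K] (Fin (N + 2) → K)} {w : Fin (N + 2) → K}
  {π : (Fin (N + 2) → K) →ₗ[K] (Fin (N + 1) → K)} {Λ : (Fin (N + 2) → K) →ₗ[K] K}

/-- The frame at the vertex `w` of the cone over the image of `e`. -/
def vertexFrame (e : (Fin (N + 1) → K) →ₗ[K] (Fin (N + 2) → K)) (w : Fin (N + 2) → K) :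
    Fin (N + 2) → Fin (N + 2) → K :=
  Fin.cons w fun j => e (Pi.single j 1)

/-- The frame at the point `e (h 0) + c • w` of the cone with vertex `w` induced by a frame `h`
at the point `h 0` of the base. -/
def coneFrame (e : (Fin (N + 1) → K) →ₗ[K] (Fin (N + 2) → K)) (w : Fin (N + 2) → K) (c : K)
    (h : Fin (N + 1) → Fin (N + 1) → K) : Fin (N + 2) → Fin (N + 2) → K :=
  Fin.cons (e (h 0) + c • w) (Fin.cons w fun j => e (h j.succ))

theorem linearIndependent_vertexFrame (hπe : ∀ u, π (e u) = u) (hΛe : ∀ u, Λ (e u) = 0)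
    (hΛw : Λ w = 1) : LinearIndependent K (vertexFrame e w) := by
  rw [vertexFrame, linearIndependent_finCons]
  constructor
  · refine LinearIndependent.of_comp π ?_
    convert (Pi.basisFun K (Fin (N + 1))).linearIndependent using 1
    ext1 j
    simp [hπe]
  · intro hw
    have : Submodule.span K (Set.range fun j => e (Pi.single j 1)) ≤ LinearMap.ker Λ := by
      rw [Submodule.span_le]
      rintro _ ⟨j, rfl⟩
      exact hΛe _
    exact one_ne_zero (hΛw.symm.trans (this hw))

theorem linearIndependent_coneFrame (hπe : ∀ u, π (e u) = u) (hπw : π w = 0)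
    (hΛe : ∀ u, Λ (e u) = 0) (hΛw : Λ w = 1) (c : K) {h : Fin (N + 1) → Fin (N + 1) → K}
    (hh : LinearIndependent K h) : LinearIndependent K (coneFrame e w c h) := by
  rw [Fintype.linearIndependent_iff] at hh ⊢
  intro g hg
  simp only [coneFrame, Fin.sum_univ_succ, Fin.cons_zero, Fin.cons_succ] at hg
  have h1 := congrArg Λ hg
  have h2 := congrArg π hg
  simp only [map_add, map_sum, map_smul, map_zero, hΛe, hΛw, hπe, hπw, smul_zero, add_zero,
    zero_add, smul_eq_mul, mul_one] at h1 h2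
  have h3 := hh (Fin.cons (g 0) fun j => g j.succ.succ) (by
    simpa [Fin.sum_univ_succ] using h2)
  have h0 : g 0 = 0 := h3 0
  refine Fin.cases h0 (Fin.cases ?_ fun j => h3 j.succ)
  simpa [h0] using h1

theorem localMap_coneFrame_pullback (hπe : ∀ u, π (e u) = u) (hπw : π w = 0) (c : K)
    (h : Fin (N + 1) → Fin (N + 1) → K) (f : MvPolynomial (Fin (N + 1)) K) :
    localMap (coneFrame e w c h) (pullback π f) = rename Fin.succ (localMap h f) := by
  have : (localMap (coneFrame e w c h)).comp (pullback π) =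
      (rename Fin.succ).comp (localMap h) := by
    ext1 i
    rw [AlgHom.comp_apply, AlgHom.comp_apply, pullback, aeval_X, localMap_linearForm, localMap,
      aeval_X, Fin.sum_univ_succ]
    simp [coneFrame, hπe, hπw]
  exact congrArg (fun φ => φ f) this

theorem localMap_coneFrame_linearForm (hΛe : ∀ u, Λ (e u) = 0) (hΛw : Λ w = 1) (c : K)
    (h : Fin (N + 1) → Fin (N + 1) → K) :
    localMap (coneFrame e w c h) (linearForm Λ) = X 0 + C c := by
  rw [localMap_linearForm, Fin.sum_univ_succ]
  simp [coneFrame, hΛe, hΛw, add_comm]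

theorem localMap_vertexFrame_pullback (hπe : ∀ u, π (e u) = u) (hπw : π w = 0)
    (f : MvPolynomial (Fin (N + 1)) K) :
    localMap (vertexFrame e w) (pullback π f) = f := by
  have : (localMap (vertexFrame e w)).comp (pullback π) = AlgHom.id K _ := by
    ext1 i
    rw [AlgHom.comp_apply, pullback, aeval_X, localMap_linearForm]
    simp [vertexFrame, hπe, hπw, Pi.single_apply, apply_ite C]
  exact congrArg (fun φ => φ f) this

theorem localMap_vertexFrame_linearForm (hΛe : ∀ u, Λ (e u) = 0) (hΛw : Λ w = 1) :
    localMap (vertexFrame e w) (linearForm Λ) = 1 := by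
  rw [localMap_linearForm]
  simp [vertexFrame, hΛe, hΛw]

/-- If the truncated jets on the base of a cone are induced by forms, then so are the jets of
bounded order along the rulings, by forms vanishing to order `m` at the vertex. -/
theorem exists_form_of_base_surjective {s m a t : ℕ} (ht : a + m ≤ t + 1)
    (hπe : ∀ u, π (e u) = u) (hπw : π w = 0) (hΛe : ∀ u, Λ (e u) = 0) (hΛw : Λ w = 1)
    (c : Fin s → K) (h : Fin s → Fin (N + 1) → Fin (N + 1) → K) {mp : Fin s → ℕ}
    (hsurj : ∀ x ≤ a, ∀ g : Fin s → MvPolynomial (Fin N) K,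
      ∃ F : MvPolynomial (Fin (N + 1)) K, F.IsHomogeneous (t - x) ∧
        ∀ i, localMap (h i) F - g i ∈ idealOfVars (Fin N) K ^ (mp i - x))
    {x : ℕ} (hx : x ≤ a) (g : Fin s → ℕ → MvPolynomial (Fin N) K) :
    ∃ F : MvPolynomial (Fin (N + 2)) K, F.IsHomogeneous t ∧
      localMap (vertexFrame e w) F ∈ idealOfVars (Fin (N + 1)) K ^ m ∧
      ∀ i, localMap (coneFrame e w (c i) (h i)) F -
        ∑ j ∈ Finset.range x, X 0 ^ j * rename Fin.succ (g i j) ∈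
          idealOfVars (Fin (N + 1)) K ^ mp i := by
  induction x generalizing g with
  | zero =>
    refine ⟨0, isHomogeneous_zero _ _ _, ?_, fun i => ?_⟩
    · rw [map_zero]
      exact Ideal.zero_mem _
    · rw [map_zero, Finset.sum_range_zero, sub_zero]
      exact Ideal.zero_mem _
  | succ x ih =>
    obtain ⟨f, hf, hfg⟩ := hsurj x (by omega) fun i => g i x
    obtain ⟨F, hF, hFo, hFg⟩ := ih (by omega) fun i j =>
      g i j - C (c i ^ (x - j) * (x.choose j : K)) * localMap (h i) f
    refine ⟨F + linearForm Λ ^ x * pullback π f, ?_, ?_, fun i => ?_⟩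
    · refine hF.add ?_
      have := ((linearForm_isHomogeneous Λ).pow x).mul (hf.pullback π)
      rwa [one_mul, Nat.add_sub_cancel' (by omega)] at this
    · rw [map_add, map_mul, map_pow, localMap_vertexFrame_linearForm hΛe hΛw, one_pow, one_mul,
        localMap_vertexFrame_pullback hπe hπw]
      exact Ideal.add_mem _ hFo (hf.mem_pow_idealOfVars (by omega))
    · have h1 : X 0 ^ x * rename Fin.succ (localMap (h i) f - g i x) ∈
          idealOfVars (Fin (N + 1)) K ^ mp i := by
        refine Ideal.pow_le_pow_right (show mp i ≤ x + (mp i - x) by omega) ?_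
        rw [pow_add]
        exact Ideal.mul_mem_mul (Ideal.pow_mem_pow (Ideal.subset_span (Set.mem_range_self 0)) x)
          (rename_succ_mem_pow_idealOfVars (hfg i))
      convert Ideal.add_mem _ (hFg i) h1 using 1
      rw [map_add, map_mul, map_pow, localMap_coneFrame_linearForm hΛe hΛw,
        localMap_coneFrame_pullback hπe hπw, add_pow, Finset.sum_range_succ,
        Finset.sum_range_succ]
      simp only [map_sub, map_mul, rename_C, mul_sub, Finset.sum_sub_distrib, map_pow,
        map_natCast, add_mul, Finset.sum_mul, Nat.sub_self, pow_zero, Nat.choose_self,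
        Nat.cast_one, mul_one]
      have h2 : ∑ j ∈ Finset.range x, X 0 ^ j * C (c i) ^ (x - j) * (x.choose j : MvPolynomial (Fin (N + 1)) K) *
          rename Fin.succ (localMap (h i) f) = ∑ j ∈ Finset.range x, X 0 ^ j *
          (C (c i) ^ (x - j) * (x.choose j : MvPolynomial (Fin (N + 1)) K) *
          rename Fin.succ (localMap (h i) f)) :=
        Finset.sum_congr rfl fun j _ => by ring
      rw [h2]
      ring

theorem cone_surjective {s m a t : ℕ} (ht : a + m ≤ t + 1)
    (hπe : ∀ u, π (e u) = u) (hπw : π w = 0) (hΛe : ∀ u, Λ (e u) = 0) (hΛw : Λ w = 1)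
    (c : Fin s → K) (h : Fin s → Fin (N + 1) → Fin (N + 1) → K) {mp : Fin s → ℕ}
    (hmp : ∀ i, mp i ≤ a)
    (hsurj : ∀ x ≤ a, ∀ g : Fin s → MvPolynomial (Fin N) K,
      ∃ F : MvPolynomial (Fin (N + 1)) K, F.IsHomogeneous (t - x) ∧
        ∀ i, localMap (h i) F - g i ∈ idealOfVars (Fin N) K ^ (mp i - x))
    (g₀ : MvPolynomial (Fin (N + 1)) K) (g : Fin s → MvPolynomial (Fin (N + 1)) K) :
    ∃ F : MvPolynomial (Fin (N + 2)) K, F.IsHomogeneous t ∧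
      localMap (vertexFrame e w) F - g₀ ∈ idealOfVars (Fin (N + 1)) K ^ m ∧
      ∀ i, localMap (coneFrame e w (c i) (h i)) F - g i ∈
          idealOfVars (Fin (N + 1)) K ^ mp i := by
  let F₀ := ∑ d ∈ Finset.range m, linearForm Λ ^ (t - d) * pullback π (homogeneousComponent d g₀)
  choose y hy using fun i => exists_sub_sum_X_zero_pow_mul_rename_mem
    (g i - localMap (coneFrame e w (c i) (h i)) F₀) a
  obtain ⟨F, hF, hFo, hFg⟩ := exists_form_of_base_surjective ht hπe hπw hΛe hΛw c h hsurj
    le_rfl y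
  refine ⟨F + F₀, hF.add (IsHomogeneous.sum _ _ _ fun d hd => ?_), ?_, fun i => ?_⟩
  · have := ((linearForm_isHomogeneous Λ).pow (t - d)).mul
      ((homogeneousComponent_isHomogeneous d g₀).pullback π)
    rw [Finset.mem_range] at hd
    rwa [one_mul, Nat.sub_add_cancel (by omega)] at this
  · rw [map_add, add_sub_assoc]
    refine Ideal.add_mem _ hFo ?_
    simp only [F₀, map_sum, map_mul, map_pow, localMap_vertexFrame_linearForm hΛe hΛw, one_pow,
      one_mul, localMap_vertexFrame_pullback hπe hπw]
    rw [mem_pow_idealOfVars_iff']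
    intro u hu
    simp [coeff_sum, coeff_homogeneousComponent, hu]
  · convert Ideal.sub_mem _ (hFg i) (Ideal.pow_le_pow_right (hmp i) (hy i)) using 1
    rw [map_add]
    ring

end Cone

theorem exists_frame {N : ℕ} {v : Fin (N + 1) → K} (hv : v ≠ 0) :
    ∃ b : Fin (N + 1) → Fin (N + 1) → K, LinearIndependent K b ∧ b 0 = v := by
  obtain ⟨W, hW⟩ := Submodule.exists_isCompl (Submodule.span K {v})
  have hdim : finrank K W = N := by
    have := Submodule.finrank_add_eq_of_isCompl hW
    rw [finrank_span_singleton hv, finrank_fin_fun] at this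
    omega
  let w := Module.finBasisOfFinrankEq K W hdim
  refine ⟨Fin.cons v fun j => w j, ?_, rfl⟩
  rw [linearIndependent_finCons]
  refine ⟨w.linearIndependent.map' W.subtype W.ker_subtype, fun h => hv ?_⟩
  have hvW : v ∈ W := Submodule.span_le.mpr (by rintro _ ⟨j, rfl⟩; exact (w j).2) h
  exact (Submodule.disjoint_def.mp hW.disjoint) v (Submodule.mem_span_singleton_self v) hvW

theorem exists_cone_coordinates {N : ℕ} {e : (Fin (N + 1) → K) →ₗ[K] (Fin (N + 2) → K)}
    (he : Function.Injective e) {w : Fin (N + 2) → K} (hw : w ∉ LinearMap.range e) :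
    ∃ (π : (Fin (N + 2) → K) →ₗ[K] (Fin (N + 1) → K)) (Λ : (Fin (N + 2) → K) →ₗ[K] K),
      (∀ u, π (e u) = u) ∧ π w = 0 ∧ (∀ u, Λ (e u) = 0) ∧ Λ w = 1 := by
  let G : ((Fin (N + 1) → K) × K) →ₗ[K] (Fin (N + 2) → K) :=
    e.coprod (LinearMap.toSpanSingleton K _ w)
  have hG : Function.Injective G := by
    rw [injective_iff_map_eq_zero]
    rintro ⟨u, c⟩ h
    simp only [G, LinearMap.coprod_apply, LinearMap.toSpanSingleton_apply] at h
    have hc : c = 0 := by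
      by_contra hc
      refine hw ⟨-(c⁻¹ • u), ?_⟩
      rw [map_neg, map_smul, eq_neg_of_add_eq_zero_left h, smul_neg, neg_neg,
        inv_smul_smul₀ hc]
    rw [hc, zero_smul, add_zero] at h
    rw [hc, (injective_iff_map_eq_zero e).mp he u h, Prod.mk_zero_zero]
  let E := LinearMap.linearEquivOfInjective G hG (by simp)
  have hEe : ∀ u, E.symm (e u) = (u, 0) := fun u => by
    rw [LinearEquiv.symm_apply_eq]
    simp [E, G]
  have hEw : E.symm w = (0, 1) := by
    rw [LinearEquiv.symm_apply_eq]
    simp [E, G]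
  exact ⟨LinearMap.fst K _ _ ∘ₗ E.symm.toLinearMap, LinearMap.snd K _ _ ∘ₗ E.symm.toLinearMap,
    fun u => by simp [hEe], by simp [hEw], fun u => by simp [hEe], by simp [hEw]⟩

theorem H1Zero.congr {N s d : ℕ} {p q : Fin s → Projectivization K (Fin (N + 1) → K)}
    {m : Fin s → ℕ} (h : ∀ i, m i ≠ 0 → p i = q i) (hp : H1Zero p m d) : H1Zero q m d := by
  have : fatIdeal q m = fatIdeal p m := iInf_congr fun i => by
    by_cases hi : m i = 0
    · rw [hi, pow_zero, pow_zero]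
    · rw [h i hi]
  rwa [H1Zero, this]

/-- **Lemma `sssr2`** (projection lemma).  Fix `n ≥ 2`, `m > 0`, `a > 0`, `t ≥ a + m − 1`,
a finite set `S = {o} ∪ {p_1,…,p_s} ⊂ ℙⁿ` and a hyperplane `H = P(V_H)` with `o ∉ H`.
Let `ℓ` be the linear projection from `o` onto `H` (here `q i = ℓ(p i)` is characterised by
lying on `H` and on the line through `o` and `p i`), injective on `S' = S ∖ {o}`.
Give `o` multiplicity `m` and `p i` multiplicity `mp i ≤ a`, and set
`Z = m·o + Σ mp_i·p_i`.  If for every `x = 0,…,a` the scheme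
`W_x = Σ max{0, mp_i − x}·ℓ(p_i)` in `H ≅ ℙⁿ⁻¹` satisfies `h¹(H, I_{W_x}(t−x)) = 0`,
then `h¹(I_Z(t)) = 0`. -/
theorem sssr2 {K : Type*} [Field K] [IsAlgClosed K] {n s : ℕ} (hn : 2 ≤ n)
    {m a t : ℕ} (hm : 0 < m) (ha : 0 < a) (ht : a + m - 1 ≤ t)
    (o : Projectivization K (Fin (n + 1) → K))
    (p : Fin s → Projectivization K (Fin (n + 1) → K))
    (hinj : Function.Injective p) (ho : o ∉ Set.range p)
    (VH : Submodule K (Fin (n + 1) → K)) (hVH : Module.finrank K VH = n)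
    (hoH : o ∉ projSet VH)
    (q : Fin s → Projectivization K (Fin (n + 1) → K))
    (hqH : ∀ i, q i ∈ projSet VH)
    (hline : ∀ i, (q i).rep ∈ Submodule.span K {o.rep, (p i).rep})
    (hqinj : Function.Injective q)
    (mp : Fin s → ℕ) (hmp : ∀ i, mp i ≤ a)
    (hW : ∀ x : ℕ, x ≤ a → H1ZeroIn (n - 2 + 1) VH q (fun i => mp i - x) (t - x)) :
    H1Zero (Fin.cons o p) (Fin.cons m mp) t := by
  obtain ⟨k, rfl⟩ : ∃ k, n = k + 2 := ⟨n - 2, by omega⟩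
  rw [Nat.add_sub_cancel] at hW
  obtain ⟨e⟩ : Nonempty ((Fin (k + 1 + 1) → K) ≃ₗ[K] VH) :=
    FiniteDimensional.nonempty_linearEquiv_of_finrank_eq (by rw [hVH, finrank_fin_fun])
  let ε : (Fin (k + 1 + 1) → K) →ₗ[K] (Fin (k + 1 + 2) → K) := VH.subtype ∘ₗ e
  have hε : Function.Injective ε := VH.injective_subtype.comp e.injective
  have hεV : ∀ u, ε u ∈ VH := fun u => (e u).2
  obtain ⟨π, Λ, hπe, hπw, hΛe, hΛw⟩ := exists_cone_coordinates hε (w := o.rep) fun ⟨u, hu⟩ =>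
    hoH (show o.rep ∈ VH from hu ▸ hεV u)
  have hq₀ : ∀ i, ∃ q₀ : Projectivization K (Fin (k + 1 + 1) → K),
      Projectivization.map ε hε q₀ = q i ∧ ∃ c b : K, b ≠ 0 ∧
        ε q₀.rep + c • o.rep = b • (p i).rep := fun i => by
    let v := e.symm ⟨(q i).rep, hqH i⟩
    have hεv : ε v = (q i).rep := by simp [ε, v]
    have hv : v ≠ 0 := fun h0 => (q i).rep_nonzero (by rw [← hεv, h0, map_zero])
    obtain ⟨r, hr⟩ := Projectivization.exists_smul_eq_mk_rep K v hv
    obtain ⟨α, β, hαβ⟩ := Submodule.mem_span_pair.mp (hline i)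
    have hβ : β ≠ 0 := by
      rintro rfl
      rw [zero_smul, add_zero] at hαβ
      have hα : α ≠ 0 := by
        rintro rfl
        exact (q i).rep_nonzero (by rw [← hαβ, zero_smul])
      refine hoH (show o.rep ∈ VH from ?_)
      rw [← VH.smul_mem_iff hα, hαβ]
      exact hqH i
    refine ⟨Projectivization.mk K v hv, ?_, -(r * α), r * β, mul_ne_zero r.ne_zero hβ, ?_⟩
    · rw [Projectivization.map_mk]
      conv_rhs => rw [← (q i).mk_rep]
      simp only [hεv]
    · rw [← hr, Units.smul_def, map_smul, hεv, ← hαβ]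
      module
  choose q₀ hq₀q c b hb hcb using hq₀
  choose h hli h0 using fun i => exists_frame (q₀ i).rep_nonzero
  have hsurj : ∀ x ≤ a, ∀ g : Fin s → MvPolynomial (Fin (k + 1)) K,
      ∃ F : MvPolynomial (Fin (k + 1 + 1)) K, F.IsHomogeneous (t - x) ∧
        ∀ i, localMap (h i) F - g i ∈ idealOfVars (Fin (k + 1)) K ^ (mp i - x) := fun x hx => by
    obtain ⟨q', hq', hH⟩ := hW x hx e
    refine (h1Zero_iff_surjective (Nat.le_add_left 1 k) hli fun i =>
      ⟨1, one_ne_zero, by rw [h0, one_smul]⟩).mp (hH.congr (q := q₀) fun i hi => ?_)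
    exact Projectivization.map_injective ε hε ((hq' i hi).trans (hq₀q i).symm)
  refine (h1Zero_iff_surjective (b := Fin.cons (vertexFrame ε o.rep)
    fun i => coneFrame ε o.rep (c i) (h i)) (Nat.le_add_left 1 (k + 1)) ?_ ?_).mpr fun g => ?_
  · exact Fin.cases (linearIndependent_vertexFrame hπe hΛe hΛw)
      fun i => linearIndependent_coneFrame hπe hπw hΛe hΛw (c i) (hli i)
  · refine Fin.cases ⟨1, one_ne_zero, (one_smul K _).symm⟩ fun i => ⟨b i, hb i, ?_⟩
    simp [coneFrame, h0, hcb]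
  · obtain ⟨F, hF, hFo, hFp⟩ := cone_surjective (m := m) (by omega) hπe hπw hΛe hΛw c h hmp hsurj
      (g 0) fun i => g i.succ
    exact ⟨F, hF, Fin.cases hFo hFp⟩
end

section
/- Let n ≥ 2 and let S ⊂ P^n be a set of n + 3 distinct points spanning P^n (i.e. contained in no hyperplane). Regard S as the fat point scheme with all multiplicities equal to 1. Then h^1(I_S(3)) = 0. If moreover no line of P^n contains 4 points of S, then h^1(I_S(2)) = 0. -/
open MvPolynomial Module

variable {K : Type*} [Field K]

lemma aeval_mul_of_isHomogeneous {σ A : Type*} [Fintype σ] [CommSemiring A] [Algebra K A]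
    {f : MvPolynomial σ K} {d : ℕ} (hf : f.IsHomogeneous d) (b : σ → K) (y : A) :
    aeval (fun i => algebraMap K A (b i) * y) f = algebraMap K A (eval b f) * y ^ d := by
  rw [aeval_def, eval₂_eq', eval_eq', map_sum, Finset.sum_mul]
  refine Finset.sum_congr rfl fun m hm => ?_
  have hd : ∑ i, m i = d := by
    rw [← hf (mem_support_iff.mp hm), Finsupp.weight_apply, Finsupp.sum_fintype] <;> simp
  simp only [mul_pow, Finset.prod_mul_distrib, map_mul, map_prod, map_pow,
    Finset.prod_pow_eq_pow_sum, hd, mul_assoc]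

lemma mem_pointIdeal_iff_of_isHomogeneous {n d : ℕ} (p : Projectivization K (Fin (n + 1) → K))
    {f : MvPolynomial (Fin (n + 1)) K} (hf : f.IsHomogeneous d) :
    f ∈ pointIdeal p ↔ eval p.rep f = 0 := by
  constructor
  · intro h
    have hle : pointIdeal p ≤ RingHom.ker (eval p.rep) := by
      rw [pointIdeal, Ideal.span_le]
      rintro _ ⟨c, hc, rfl⟩
      simpa [RingHom.mem_ker] using hc
    exact hle h
  · intro h
    obtain ⟨k, hk⟩ := Function.ne_iff.mp p.rep_nonzero
    have hk : p.rep k ≠ 0 := hk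
    set a := p.rep with ha
    rw [← Ideal.Quotient.eq_zero_iff_mem]
    have hX : ∀ i, Ideal.Quotient.mkₐ K (pointIdeal p) (X i) =
        algebraMap K _ (a i) * Ideal.Quotient.mkₐ K (pointIdeal p) (C (a k)⁻¹ * X k) := by
      intro i
      have hC : algebraMap K (MvPolynomial (Fin (n + 1)) K ⧸ pointIdeal p) (a i) =
          Ideal.Quotient.mkₐ K (pointIdeal p) (C (a i)) :=
        ((Ideal.Quotient.mkₐ K (pointIdeal p)).commutes _).symm
      rw [hC, ← map_mul, Ideal.Quotient.mkₐ_eq_mk, Ideal.Quotient.eq]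
      refine Ideal.subset_span ⟨Pi.single i 1 - Pi.single k (a i * (a k)⁻¹), ?_, ?_⟩
      · simp [sub_mul, Finset.sum_sub_distrib, Pi.single_apply, ite_mul, ← ha, hk]
      · have hs : ∀ (j : Fin (n + 1)) (r : K),
            ∑ i, C ((Pi.single j r : Fin (n + 1) → K) i) * X i =
              (C r * X j : MvPolynomial (Fin (n + 1)) K) := by
          intro j r
          rw [Finset.sum_eq_single j] <;> simp +contextual
        simp only [Pi.sub_apply, map_sub, sub_mul, Finset.sum_sub_distrib, hs]
        simp [mul_assoc]
    have key : Ideal.Quotient.mkₐ K (pointIdeal p) f =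
        aeval (fun i => Ideal.Quotient.mkₐ K (pointIdeal p) (X i)) f := by
      rw [← comp_aeval_apply, aeval_X_left_apply]
    rw [← Ideal.Quotient.mkₐ_eq_mk K, key, funext hX, aeval_mul_of_isHomogeneous hf, h]
    simp

/-- Evaluation of polynomials at the chosen representatives of finitely many points. -/
noncomputable def evalReps {n s : ℕ} (p : Fin s → Projectivization K (Fin (n + 1) → K)) :
    MvPolynomial (Fin (n + 1)) K →ₗ[K] (Fin s → K) :=
  LinearMap.pi fun i => (aeval (p i).rep).toLinearMap

lemma evalReps_apply {n s : ℕ} (p : Fin s → Projectivization K (Fin (n + 1) → K))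
    (f : MvPolynomial (Fin (n + 1)) K) (i : Fin s) :
    evalReps p f i = eval (p i).rep f := by
  simp [evalReps, aeval_eq_eval]

lemma hilbDim_fatIdeal_one {n s : ℕ} (p : Fin s → Projectivization K (Fin (n + 1) → K)) (d : ℕ) :
    hilbDim (fatIdeal p fun _ => 1) d =
      finrank K (Submodule.map (evalReps p) (homogeneousSubmodule (Fin (n + 1)) K d)) := by
  rw [hilbDim, ← LinearMap.range_domRestrict, ← LinearMap.range_domRestrict]
  refine LinearEquiv.finrank_eq <| (LinearMap.quotKerEquivRange _).symm ≪≫ₗ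
    Submodule.quotEquivOfEq _ _ ?_ ≪≫ₗ LinearMap.quotKerEquivRange _
  ext ⟨f, hf⟩
  rw [mem_homogeneousSubmodule] at hf
  rw [LinearMap.mem_ker, LinearMap.mem_ker, LinearMap.domRestrict_apply,
    LinearMap.domRestrict_apply, AlgHom.toLinearMap_apply, Ideal.Quotient.mkₐ_eq_mk,
    Ideal.Quotient.eq_zero_iff_mem, funext_iff]
  simp [fatIdeal, evalReps_apply, mem_pointIdeal_iff_of_isHomogeneous _ hf]

lemma h1Zero_one_of_separating {n s : ℕ} (p : Fin s → Projectivization K (Fin (n + 1) → K))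
    (d : ℕ) (h : ∀ i, ∃ f : MvPolynomial (Fin (n + 1)) K, f.IsHomogeneous d ∧
      eval (p i).rep f ≠ 0 ∧ ∀ j ≠ i, eval (p j).rep f = 0) :
    H1Zero p (fun _ => 1) d := by
  have htop : Submodule.map (evalReps p) (homogeneousSubmodule (Fin (n + 1)) K d) = ⊤ := by
    rw [eq_top_iff, ← (Pi.basisFun K (Fin s)).span_eq, Submodule.span_le]
    rintro _ ⟨i, rfl⟩
    obtain ⟨f, hf, hi, hj⟩ := h i
    refine ⟨(eval (p i).rep f)⁻¹ • f, Submodule.smul_mem _ _ hf, ?_⟩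
    ext j
    rw [map_smul, Pi.smul_apply, evalReps_apply, Pi.basisFun_apply]
    obtain rfl | hne := eq_or_ne j i
    · simp [hi]
    · simp [hj j hne, hne]
  rw [H1Zero, hilbDim_fatIdeal_one, htop, finrank_top]
  simp [expDeg]

/-- The linear form with the same values as a given linear functional. -/
noncomputable def formOfDual {n : ℕ} (l : (Fin (n + 1) → K) →ₗ[K] K) :
    MvPolynomial (Fin (n + 1)) K :=
  ∑ i, C (l (Pi.single i 1)) * X i

lemma isHomogeneous_formOfDual {n : ℕ} (l : (Fin (n + 1) → K) →ₗ[K] K) :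
    (formOfDual l).IsHomogeneous 1 :=
  IsHomogeneous.sum _ _ _ fun i _ => (isHomogeneous_X K i).C_mul _

lemma eval_formOfDual {n : ℕ} (l : (Fin (n + 1) → K) →ₗ[K] K) (a : Fin (n + 1) → K) :
    eval a (formOfDual l) = l a := by
  conv_rhs => rw [pi_eq_sum_univ' a]
  simp [formOfDual, mul_comm]

section Separation

variable {ι V : Type*} [AddCommGroup V] [Module K V]

lemma exists_dual_separating {v : ι → V} {i : ι} {t : Set ι}
    (h : v i ∉ Submodule.span K (v '' t)) :
    ∃ l : V →ₗ[K] K, l (v i) ≠ 0 ∧ ∀ j ∈ t, l (v j) = 0 := by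
  obtain ⟨l, hl, hle⟩ := Submodule.exists_le_ker_of_notMem h
  exact ⟨l, hl, fun j hj => hle (Submodule.subset_span ⟨j, hj, rfl⟩)⟩

lemma exists_basis_finset_mem [Finite ι] [FiniteDimensional K V] {v : ι → V}
    (hspan : Submodule.span K (Set.range v) = ⊤) {i : ι} (hi : v i ≠ 0) :
    ∃ s : Finset ι, i ∈ s ∧ LinearIndepOn K v s ∧ s.card = finrank K V := by
  obtain ⟨b, -, hib, hb, hlin⟩ := exists_linearIndepOn_extension
    (LinearIndepOn.singleton (R := K) (v := v) hi) (Set.subset_univ _)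
  rw [Set.image_univ, ← Submodule.span_le, hspan, top_le_iff] at hb
  lift b to Finset ι using b.toFinite
  refine ⟨b, by simpa using hib, hlin, ?_⟩
  have := finrank_span_eq_card (R := K) hlin
  rw [← Set.image_eq_range, hb, finrank_top] at this
  simpa using this.symm

lemma exists_basis_finset_exchange [DecidableEq ι] [FiniteDimensional K V] {v : ι → V}
    {s : Finset ι}
    (hs : LinearIndepOn K v s) (hcard : s.card = finrank K V) {i q : ι} (hi : i ∈ s)
    (hqi : v q ∉ Submodule.span K {v i}) :
    ∃ b ∈ s, b ≠ i ∧ LinearIndepOn K v (insert q (s.erase b) : Finset ι) := by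
  have htop : Submodule.span K (v '' s) = ⊤ := by
    rw [Set.image_eq_range]
    exact hs.span_eq_top_of_card_eq_finrank' (by simpa using hcard)
  have hmem : v q ∈ Submodule.span K (v '' s) := htop ▸ Submodule.mem_top
  obtain ⟨c, hc⟩ := Submodule.mem_span_image_finset_iff_exists_fun' K |>.mp hmem
  obtain ⟨b, hb, hbi, hcb⟩ : ∃ b ∈ s, b ≠ i ∧ c b ≠ 0 := by
    by_contra! h
    apply hqi
    rw [← hc, Finset.sum_eq_single_of_mem i hi fun j hj hji => by rw [h j hj hji, zero_smul]]
    exact Submodule.smul_mem _ _ (Submodule.mem_span_singleton_self _)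
  refine ⟨b, hb, hbi, ?_⟩
  rw [Finset.coe_insert]
  refine (hs.mono (by simp)).insert fun hcon => ?_
  have hbs : v b ∉ Submodule.span K (v '' (s.erase b : Finset ι)) := by
    refine LinearIndepOn.notMem_span_of_insert ?_ (by simp)
    rwa [← Finset.coe_insert, Finset.insert_erase hb]
  apply hbs
  rw [← Submodule.smul_mem_iff _ hcb]
  have : c b • v b = v q - ∑ j ∈ s.erase b, c j • v j := by
    rw [← hc, ← Finset.add_sum_erase s _ hb, add_sub_cancel_right]
  rw [this]
  exact sub_mem hcon (sum_mem fun j hj =>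
    Submodule.smul_mem _ _ (Submodule.subset_span ⟨j, hj, rfl⟩))

lemma exists_dual_eq_zero_on_erase [DecidableEq ι] {v : ι → V} {s : Finset ι}
    (hs : LinearIndepOn K v s) {i : ι} (hi : i ∈ s) :
    ∃ l : V →ₗ[K] K, l (v i) ≠ 0 ∧ ∀ j ∈ s, j ≠ i → l (v j) = 0 := by
  obtain ⟨l, hl, hl0⟩ := exists_dual_separating (K := K) (v := v) (i := i) (t := s.erase i) (by
    refine LinearIndepOn.notMem_span_of_insert ?_ (by simp)
    rwa [← Finset.coe_insert, Finset.insert_erase hi])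
  exact ⟨l, hl, fun j hj hji => hl0 j (by simp [hj, hji])⟩

lemma exists_compl_eq_pair [Fintype ι] [DecidableEq ι]
    (hι : Fintype.card ι = finrank K V + 2) {s : Finset ι} (hcard : s.card = finrank K V) :
    ∃ q r, q ≠ r ∧ sᶜ = {q, r} := by
  rw [← Finset.card_eq_two, Finset.card_compl]
  omega

/-- Two points outside a basis can be chosen so that they do not span a line through a prescribed
basis point, provided that no four of the points are collinear. -/
lemma exists_basis_finset_notMem_span_pair [Fintype ι] [DecidableEq ι]
    [FiniteDimensional K V] (hι : Fintype.card ι = finrank K V + 2) {v : ι → V}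
    (hspan : Submodule.span K (Set.range v) = ⊤)
    (hpair : ∀ a b, a ≠ b → LinearIndepOn K v {a, b})
    (hfour : ∀ a b c d, a ≠ b → c ≠ a → c ≠ b → d ≠ a → d ≠ b → c ≠ d →
      v c ∈ Submodule.span K {v a, v b} → v d ∉ Submodule.span K {v a, v b}) (i : ι) :
    ∃ s : Finset ι, i ∈ s ∧ LinearIndepOn K v s ∧ ∃ q r, sᶜ = {q, r} ∧
      v i ∉ Submodule.span K {v q, v r} := by
  have hswap : ∀ {x a b : ι}, x ≠ b → v x ∈ Submodule.span K {v a, v b} →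
      v a ∈ Submodule.span K {v x, v b} := by
    intro x a b hxb hx
    refine mem_span_insert_exchange hx fun hx' => ?_
    refine LinearIndepOn.notMem_span_of_insert (hpair x b hxb) (by simpa using hxb) ?_
    simpa using hx'
  have hi : v i ≠ 0 := by
    obtain ⟨j, hj⟩ : ∃ j, i ≠ j := by
      have : Nontrivial ι := Fintype.one_lt_card_iff_nontrivial.mp (by omega)
      exact (exists_ne i).imp fun _ h => h.symm
    exact (hpair i j hj).ne_zero (by simp)
  obtain ⟨s, his, hs, hcard⟩ := exists_basis_finset_mem hspan hi
  obtain ⟨q, r, hqr, hsc⟩ := exists_compl_eq_pair hι hcard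
  by_cases hbad : v i ∈ Submodule.span K {v q, v r}
  swap
  · exact ⟨s, his, hs, q, r, hsc, hbad⟩
  have hmem : ∀ x, x ∉ s ↔ x = q ∨ x = r := fun x => by
    rw [← Finset.mem_compl, hsc]
    simp
  have hqs : q ∉ s := (hmem q).2 (.inl rfl)
  have hrs : r ∉ s := (hmem r).2 (.inr rfl)
  have hiq : i ≠ q := fun h => hqs (h ▸ his)
  have hir : i ≠ r := fun h => hrs (h ▸ his)
  obtain ⟨b, hb, hbi, hs'⟩ := exists_basis_finset_exchange hs hcard his (fun h =>
    LinearIndepOn.notMem_span_of_insert (hpair q i hiq.symm) (by simpa using hiq.symm)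
      (by simpa using h))
  have hbq : b ≠ q := fun h => hqs (h ▸ hb)
  have hbr : b ≠ r := fun h => hrs (h ▸ hb)
  refine ⟨_, by simp [his, hbi.symm], hs', b, r, ?_, fun hcon => ?_⟩
  · ext x
    have := hmem x
    simp only [Finset.mem_compl, Finset.mem_insert, Finset.mem_erase, Finset.mem_singleton]
    grind
  · exact hfour i r q b hir hiq.symm hqr hbi hbr hbq.symm (hswap hir hbad) (hswap hir hcon)

end Separation

/-- The base case `w(Z) = n + 3` of Theorem `segre for arbitrary n+3`:
if `S` is a set of `n + 3` distinct points spanning `ℙⁿ` (`n ≥ 2`), then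
`h¹(I_S(3)) = 0`; and if moreover no line contains `4` points of `S`, then
`h¹(I_S(2)) = 0`. -/
theorem simple_points_n_plus_three {K : Type*} [Field K] [IsAlgClosed K]
    {n : ℕ} (hn : 2 ≤ n)
    (p : Fin (n + 3) → Projectivization K (Fin (n + 1) → K))
    (hinj : Function.Injective p)
    (hspan : Submodule.span K (Set.range fun i => (p i).rep) = ⊤) :
    H1Zero p (fun _ => 1) 3 ∧
      ((∀ V : Submodule K (Fin (n + 1) → K), Module.finrank K V = 2 →
          (Set.range p ∩ projSet V).ncard ≤ 3) →
        H1Zero p (fun _ => 1) 2) := by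
  set v : Fin (n + 3) → Fin (n + 1) → K := fun i => (p i).rep
  have hι : Fintype.card (Fin (n + 3)) = finrank K (Fin (n + 1) → K) + 2 := by simp
  have hpair' : ∀ a b, a ≠ b → LinearIndependent K ![v a, v b] := by
    intro a b hab
    have := (Projectivization.independent_pair_iff_ne (p a) (p b)).2 (hinj.ne hab)
    rw [Projectivization.independent_iff] at this
    have hcomp : Projectivization.rep ∘ ![p a, p b] = ![v a, v b] := by
      ext j : 1
      fin_cases j <;> rfl
    rwa [hcomp] at this
  have hpair : ∀ a b, a ≠ b → LinearIndepOn K v {a, b} := by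
    intro a b hab
    rw [LinearIndepOn.pair_iff v hab]
    exact LinearIndependent.pair_iff.1 (hpair' a b hab)
  refine ⟨h1Zero_one_of_separating p 3 fun i => ?_,
    fun hline => h1Zero_one_of_separating p 2 fun i => ?_⟩
  · obtain ⟨s, his, hs, hcard⟩ := exists_basis_finset_mem hspan (p i).rep_nonzero
    obtain ⟨q, r, -, hsc⟩ := exists_compl_eq_pair hι hcard
    have hmem : ∀ x, x ∉ s ↔ x = q ∨ x = r := fun x => by
      rw [← Finset.mem_compl, hsc]
      simp
    have hpt : ∀ q ∉ s, ∃ l : (Fin (n + 1) → K) →ₗ[K] K, l (v i) ≠ 0 ∧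
        ∀ j ∈ ({q} : Set (Fin (n + 3))), l (v j) = 0 := fun q hq => by
      have hiq : i ≠ q := fun h => hq (h ▸ his)
      exact exists_dual_separating
        (LinearIndepOn.notMem_span_of_insert (hpair i q hiq) (by simpa using hiq))
    obtain ⟨l, hl, hl0⟩ := exists_dual_eq_zero_on_erase hs his
    obtain ⟨l₁, hl₁, hl₁0⟩ := hpt q ((hmem q).2 (.inl rfl))
    obtain ⟨l₂, hl₂, hl₂0⟩ := hpt r ((hmem r).2 (.inr rfl))
    refine ⟨formOfDual l * formOfDual l₁ * formOfDual l₂,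
      ((isHomogeneous_formOfDual l).mul (isHomogeneous_formOfDual l₁)).mul
        (isHomogeneous_formOfDual l₂), ?_, fun j hj => ?_⟩
    · simp only [map_mul, eval_formOfDual]
      exact mul_ne_zero (mul_ne_zero hl hl₁) hl₂
    · simp only [map_mul, eval_formOfDual, mul_eq_zero]
      by_cases hjs : j ∈ s
      · exact .inl (.inl (hl0 j hjs hj))
      · exact ((hmem j).1 hjs).elim (fun h => .inl (.inr (hl₁0 j h))) fun h => .inr (hl₂0 j h)
  · have hfour : ∀ a b c d, a ≠ b → c ≠ a → c ≠ b → d ≠ a → d ≠ b → c ≠ d →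
        v c ∈ Submodule.span K {v a, v b} → v d ∉ Submodule.span K {v a, v b} := by
      classical
      intro a b c d hab hca hcb hda hdb hcd hc hd
      have hrank : finrank K (Submodule.span K {v a, v b}) = 2 := by
        rw [← Matrix.range_cons_cons_empty (v a) (v b) ![], finrank_span_eq_card (hpair' a b hab),
          Fintype.card_fin]
      have hle := hline _ hrank
      have hsub : (({a, b, c, d} : Finset (Fin (n + 3))).image p : Set _) ⊆
          Set.range p ∩ projSet (Submodule.span K {v a, v b}) := by
        intro x hx
        simp only [Finset.coe_image, Finset.coe_insert, Finset.coe_singleton, Set.mem_image,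
          Set.mem_insert_iff, Set.mem_singleton_iff] at hx
        obtain ⟨y, hy, rfl⟩ := hx
        refine ⟨⟨y, rfl⟩, ?_⟩
        change v y ∈ Submodule.span K {v a, v b}
        rcases hy with rfl | rfl | rfl | rfl
        · exact Submodule.subset_span (by simp)
        · exact Submodule.subset_span (by simp)
        · exact hc
        · exact hd
      have hge := Set.ncard_le_ncard hsub ((Set.finite_range p).inter_of_left _)
      rw [Set.ncard_coe_finset, Finset.card_image_of_injective _ hinj] at hge
      have : ({a, b, c, d} : Finset (Fin (n + 3))).card = 4 := by
        rw [Finset.card_eq_succ]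
        refine ⟨a, {b, c, d}, by simp [hab, hca.symm, hda.symm], rfl, ?_⟩
        exact Finset.card_eq_three.2 ⟨b, c, d, hcb.symm, hdb.symm, hcd, rfl⟩
      omega
    obtain ⟨s, his, hs, q, r, hsc, hqr⟩ :=
      exists_basis_finset_notMem_span_pair hι hspan hpair hfour i
    obtain ⟨l, hl, hl0⟩ := exists_dual_eq_zero_on_erase hs his
    obtain ⟨l₁, hl₁, hl₁0⟩ := exists_dual_separating (v := v) (i := i) (t := {q, r})
      (by rwa [Set.image_pair])
    refine ⟨formOfDual l * formOfDual l₁,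
      (isHomogeneous_formOfDual l).mul (isHomogeneous_formOfDual l₁), ?_, fun j hj => ?_⟩
    · simp only [map_mul, eval_formOfDual]
      exact mul_ne_zero hl hl₁
    · simp only [map_mul, eval_formOfDual, mul_eq_zero]
      by_cases hjs : j ∈ s
      · exact .inl (hl0 j hjs hj)
      · refine .inr (hl₁0 j ?_)
        rw [← Finset.mem_compl, hsc] at hjs
        simpa using hjs
end
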